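/- For any constant ω > 0 and all sufficiently large integers N, \sum_{p \le N} | \sum_{d | p-1, \sqrt{N} L^{-ω} < d < \sqrt{N} L^{ω}} χ(d) | \ll N L^{-1-\theta_0} (\log L)^5, where p runs over primes, L = log N, θ_0 = 1/2 - (1/4) e log 2, and the implied constant depends only on ω. -/

import Mathlib

open Finset

noncomputable section

/-- The non-principal Dirichlet character modulo 4. -/
def chi4 (n : ℕ) : ℝ := if n % 4 = 1 then 1 else if n % 4 = 3 then -1 else 0

/-- θ₀ = 1/2 - (1/4) e log 2. -/
def theta0 : ℝ := 1 / 2 - (1 / 4) * Real.exp 1 * Real.log 2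

/-- Comparison form of partial summation: weighting by a nonincreasing nonnegative `w` preserves
inequalities between all partial sums. -/
lemma sum_mul_antitone_nonneg {f w : ℕ → ℝ} {m : ℕ}
    (hf : ∀ n, m ≤ n → 0 ≤ ∑ k ∈ Icc m n, f k)
    (hw : ∀ n, m ≤ n → w (n + 1) ≤ w n) (n : ℕ) (hn : m ≤ n) :
    (∑ k ∈ Icc m n, f k) * w n ≤ ∑ k ∈ Icc m n, f k * w k := by
  induction n, hn using Nat.le_induction with
  | base => simp
  | succ n hn ih =>
    rw [Finset.sum_Icc_succ_top (by omega), Finset.sum_Icc_succ_top (by omega), add_mul]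
    have := mul_le_mul_of_nonneg_left (hw n hn) (hf n hn)
    linarith

lemma div_le_factorization_factorial {p : ℕ} (hp : p.Prime) (n : ℕ) :
    n / p ≤ (n.factorial).factorization p := by
  have := Fact.mk hp
  rw [Nat.factorization_def _ hp, ← padicValNat_mul_div_factorial (p := p) n,
    padicValNat_factorial_mul]
  omega

lemma sum_log_div_prime_le (n : ℕ) (hn : 1 ≤ n) :
    ∑ p ∈ Nat.primesLE n, Real.log p / p ≤ Real.log n + Real.log 4 := by
  have hn0 : (0 : ℝ) < n := by exact_mod_cast hn
  have h1 : ∑ p ∈ Nat.primesLE n, ((n / p : ℕ) : ℝ) * Real.log p ≤ Real.log (n.factorial) := by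
    have hdvd : ∏ p ∈ Nat.primesLE n, p ^ (n / p) ∣ n.factorial := by
      apply Finset.prod_dvd_of_isRelPrime
      · intro p hp q hq hpq
        exact Nat.coprime_iff_isRelPrime.1 (Nat.Coprime.pow _ _
          ((Nat.coprime_primes (Nat.prime_of_mem_primesLE hp)
            (Nat.prime_of_mem_primesLE hq)).2 hpq))
      · intro p hp
        have hp' := Nat.prime_of_mem_primesLE hp
        exact (hp'.pow_dvd_iff_le_factorization (Nat.factorial_ne_zero n)).2
          (div_le_factorization_factorial hp' n)
    have h2 := Nat.le_of_dvd (Nat.factorial_pos n) hdvd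
    have h3 : Real.log ((∏ p ∈ Nat.primesLE n, p ^ (n / p) : ℕ) : ℝ)
        = ∑ p ∈ Nat.primesLE n, ((n / p : ℕ) : ℝ) * Real.log p := by
      push_cast
      rw [Real.log_prod]
      · simp
      · intro p hp
        have := (Nat.prime_of_mem_primesLE hp).ne_zero
        positivity
    rw [← h3]
    apply Real.log_le_log
    · exact_mod_cast Finset.prod_pos fun p hp => pow_pos (Nat.prime_of_mem_primesLE hp).pos _
    · exact_mod_cast h2
  have h2 : Real.log (n.factorial) ≤ n * Real.log n := by
    rw [← Real.log_pow]
    apply Real.log_le_log (by exact_mod_cast Nat.factorial_pos n)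
    exact_mod_cast Nat.factorial_le_pow n
  have h3 : ∀ p ∈ Nat.primesLE n, (n : ℝ) * (Real.log p / p) - Real.log p
      ≤ ((n / p : ℕ) : ℝ) * Real.log p := by
    intro p hp
    have hp' := Nat.prime_of_mem_primesLE hp
    have hl : 0 ≤ Real.log p := Real.log_natCast_nonneg p
    have : (n : ℝ) / p - 1 ≤ ((n / p : ℕ) : ℝ) := by
      have h := Nat.lt_floor_add_one ((n : ℝ) / p)
      rw [Nat.floor_div_eq_div] at h
      linarith
    have := mul_le_mul_of_nonneg_right this hl
    calc _ = ((n : ℝ) / p - 1) * Real.log p := by ring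
      _ ≤ _ := this
  have h4 := Finset.sum_le_sum h3
  rw [Finset.sum_sub_distrib, ← Finset.mul_sum, ← Chebyshev.theta_eq_sum_primesLE_log] at h4
  have h5 := Chebyshev.theta_le_log4_mul_x (x := n) hn0.le
  have : (n : ℝ) * ∑ p ∈ Nat.primesLE n, Real.log p / p ≤ n * (Real.log n + Real.log 4) := by
    linarith
  exact le_of_mul_le_mul_left this hn0

/-- Mertens' upper bound. -/
lemma exists_sum_inv_prime_le : ∃ C : ℝ, 0 ≤ C ∧ ∀ n : ℕ, 2 ≤ n →
    ∑ p ∈ Nat.primesLE n, (1 : ℝ) / p ≤ Real.log (Real.log n) + C := by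
  have hl2 : 0 < Real.log 2 := Real.log_pos (by norm_num)
  set B : ℝ := (Real.log 2 + Real.log 4) / Real.log 2 - Real.log (Real.log 2) with hB
  refine ⟨|B|, abs_nonneg _, fun n hn => ?_⟩
  let a : ℕ → ℝ := fun k => if k.Prime then Real.log k / k else 0
  let b : ℕ → ℝ := fun k => if k = 2 then Real.log 2 + Real.log 4
    else Real.log k - Real.log (k - 1 : ℕ)
  let w : ℕ → ℝ := fun k => 1 / Real.log k
  have hsumP : ∀ (g : ℕ → ℝ) (n : ℕ), ∑ p ∈ Nat.primesLE n, g p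
      = ∑ k ∈ Icc 2 n, if k.Prime then g k else 0 := by
    intro g n
    rw [← Finset.sum_filter]
    apply Finset.sum_congr _ (fun _ _ => rfl)
    ext p
    simp only [Nat.mem_primesLE, mem_filter, mem_Icc]
    exact ⟨fun h => ⟨⟨h.2.two_le, h.1⟩, h.2⟩, fun h => ⟨h.1.2, h.2⟩⟩
  have hbsum : ∀ n, 2 ≤ n → ∑ k ∈ Icc 2 n, b k = Real.log n + Real.log 4 := by
    intro n hn
    induction n, hn using Nat.le_induction with
    | base => simp [b]
    | succ n hn ih =>
      rw [Finset.sum_Icc_succ_top (by omega), ih]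
      simp only [b]
      rw [if_neg (by omega), Nat.add_sub_cancel]
      ring
  have hpos : ∀ n, 2 ≤ n → 0 ≤ ∑ k ∈ Icc 2 n, (b k - a k) := by
    intro n hn
    rw [Finset.sum_sub_distrib, hbsum n hn, ← hsumP (fun k => Real.log k / k)]
    linarith [sum_log_div_prime_le n (by omega)]
  have hlog : ∀ n : ℕ, 2 ≤ n → 0 < Real.log n := fun n hn =>
    Real.log_pos (by exact_mod_cast hn)
  have hw : ∀ n, 2 ≤ n → w (n + 1) ≤ w n := by
    intro n hn
    apply one_div_le_one_div_of_le (hlog n hn)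
    apply Real.log_le_log (by positivity)
    push_cast; linarith
  have h1 := sum_mul_antitone_nonneg hpos hw n hn
  have h2 : 0 ≤ (∑ k ∈ Icc 2 n, (b k - a k)) * w n :=
    mul_nonneg (hpos n hn) (one_div_nonneg.2 (hlog n hn).le)
  simp only [sub_mul, Finset.sum_sub_distrib] at h1
  have h3 : ∑ k ∈ Icc 2 n, a k * w k = ∑ p ∈ Nat.primesLE n, (1 : ℝ) / p := by
    rw [hsumP]
    apply Finset.sum_congr rfl
    intro k hk
    have := hlog k (mem_Icc.1 hk).1
    simp only [a, w]
    split_ifs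
    · field_simp
    · simp
  have h4 : ∀ n, 2 ≤ n → ∑ k ∈ Icc 2 n, b k * w k ≤ Real.log (Real.log n) + B := by
    intro n hn
    induction n, hn using Nat.le_induction with
    | base => simp [b, w, hB]; rw [div_eq_mul_inv]
    | succ n hn ih =>
      rw [Finset.sum_Icc_succ_top (by omega)]
      have e : b (n + 1) * w (n + 1)
          ≤ Real.log (Real.log (n + 1 : ℕ)) - Real.log (Real.log n) := by
        have p1 := hlog n hn
        have p2 := hlog (n + 1) (by omega)
        have := Real.one_sub_inv_le_log_of_pos (div_pos p2 p1)
        rw [Real.log_div p2.ne' p1.ne'] at this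
        refine le_trans (le_of_eq ?_) this
        simp only [b, w]
        rw [if_neg (by omega)]
        simp only [Nat.add_sub_cancel]
        field_simp
      linarith
  have h5 := h4 n hn
  have h6 := le_abs_self B
  rw [← h3]
  simp only [sub_mul, Finset.sum_sub_distrib] at h2
  linarith

lemma sum_inv_mul_pred_le (n : ℕ) :
    ∑ p ∈ Nat.primesLE n, (1 : ℝ) / (p * (p - 1)) ≤ 1 := by
  have h : ∀ m : ℕ, 1 ≤ m → ∑ k ∈ Icc 2 m, (1 : ℝ) / (k * (k - 1)) ≤ 1 - 1 / m := by
    intro m hm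
    induction m, hm using Nat.le_induction with
    | base => simp
    | succ m hm ih =>
      rw [Finset.sum_Icc_succ_top (by omega)]
      have : (1 : ℝ) / ((m + 1 : ℕ) * ((m + 1 : ℕ) - 1)) = 1 / m - 1 / (m + 1 : ℕ) := by
        have : (0 : ℝ) < m := by exact_mod_cast hm
        push_cast
        rw [add_sub_cancel_right]
        field_simp
        ring
      linarith
  have hsub : Nat.primesLE n ⊆ Icc 2 (n + 1) := by
    intro p hp
    rw [Nat.mem_primesLE] at hp
    exact mem_Icc.2 ⟨hp.2.two_le, by omega⟩
  refine (Finset.sum_le_sum_of_subset_of_nonneg hsub ?_).trans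
    ((h (n + 1) (by omega)).trans (by simp; positivity))
  intro k hk _
  have : (2 : ℝ) ≤ k := by exact_mod_cast (mem_Icc.1 hk).1
  have : (0 : ℝ) ≤ (k : ℝ) - 1 := by linarith
  positivity

/-- The reciprocal function as a monoid homomorphism. -/
def natInvHom : ℕ →* ℝ where
  toFun n := (n : ℝ)⁻¹
  map_one' := by simp
  map_mul' := by intro a b; push_cast; rw [mul_inv]

/-- Mertens' lower bound. -/
lemma log_log_le_sum_inv_prime (n : ℕ) (hn : 2 ≤ n) :
    Real.log (Real.log n) - 1 ≤ ∑ p ∈ Nat.primesLE n, (1 : ℝ) / p := by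
  have hlog : 0 < Real.log n := Real.log_pos (by exact_mod_cast hn)
  obtain ⟨hs, hS⟩ := EulerProduct.summable_and_hasSum_smoothNumbers_prod_primesBelow_geometric
    (f := natInvHom) (by
      intro p hp
      simp only [natInvHom, MonoidHom.coe_mk, OneHom.coe_mk]
      rw [norm_inv, Real.norm_natCast]
      exact inv_lt_one_of_one_lt₀ (by exact_mod_cast hp.one_lt)) (n + 1)
  have h1 : (harmonic n : ℝ) ≤ ∏ p ∈ Nat.primesLE n, (1 - (p : ℝ)⁻¹)⁻¹ := by
    have h2 : ∀ m ∈ Icc 1 n, m ∈ (n + 1).smoothNumbers := by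
      intro m hm
      rw [mem_Icc] at hm
      exact Nat.mem_smoothNumbers_of_lt (by omega) (by omega)
    have h3 := sum_le_hasSum ((Icc 1 n).attach.image
      (fun m => (⟨m.1, h2 m.1 m.2⟩ : (n + 1).smoothNumbers)))
      (fun i _ => by simp [natInvHom]) hS
    rw [Finset.sum_image (by intro x _ y _ h; exact Subtype.ext (congrArg Subtype.val h :))] at h3
    rw [harmonic_eq_sum_Icc]
    push_cast
    rw [← Finset.sum_attach]
    exact h3
  have h2 : Real.log n ≤ harmonic n := by
    have := log_le_harmonic_floor (n : ℝ) (by positivity)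
    simpa using this
  have h3 : ∏ p ∈ Nat.primesLE n, (1 - (p : ℝ)⁻¹)⁻¹
      ≤ Real.exp (∑ p ∈ Nat.primesLE n, ((1 : ℝ) / p + 1 / (p * (p - 1)))) := by
    rw [Real.exp_sum]
    apply Finset.prod_le_prod
    · intro p hp
      have : (2 : ℝ) ≤ p := by exact_mod_cast (Nat.two_le_of_mem_primesLE hp)
      have : (p : ℝ)⁻¹ ≤ 1 := inv_le_one_of_one_le₀ (by linarith)
      exact inv_nonneg.2 (by linarith)
    · intro p hp
      have h2 : (2 : ℝ) ≤ p := by exact_mod_cast (Nat.two_le_of_mem_primesLE hp)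
      have h3 : (0 : ℝ) < (p : ℝ) - 1 := by linarith
      have : (1 - (p : ℝ)⁻¹)⁻¹ = 1 / (p - 1) + 1 := by
        have : (1 - (p : ℝ)⁻¹) ≠ 0 := by
          have : (p : ℝ)⁻¹ ≤ 2⁻¹ := inv_anti₀ (by norm_num) h2
          norm_num at this ⊢
          intro h; linarith
        field_simp
        ring
      rw [this]
      have e : (1 : ℝ) / p + 1 / (p * (p - 1)) = 1 / (p - 1) := by
        field_simp
        ring
      rw [e]
      exact Real.add_one_le_exp _
  have h4 := Real.log_le_log hlog (h2.trans (h1.trans h3))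
  rw [Real.log_exp, Finset.sum_add_distrib] at h4
  linarith [sum_inv_mul_pred_le n]

/-- The subsets of `P` with at most `R` elements. -/
def smallSubsets (P : Finset ℕ) (R : ℕ) : Finset (Finset ℕ) := P.powerset.filter (fun m => #m ≤ R)

/-- The inclusion-exclusion expansion of `∏ p ∈ P, (1 - x p)`, truncated at terms of degree `R`. -/
def truncProd (P : Finset ℕ) (R : ℕ) (x : ℕ → ℝ) : ℝ :=
  ∑ m ∈ smallSubsets P R, ∏ p ∈ m, (-x p)

lemma mem_smallSubsets {P : Finset ℕ} {R : ℕ} {m : Finset ℕ} :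
    m ∈ smallSubsets P R ↔ m ⊆ P ∧ #m ≤ R := by simp [smallSubsets]

lemma truncProd_zero (P : Finset ℕ) (x : ℕ → ℝ) : truncProd P 0 x = 1 := by
  have : smallSubsets P 0 = {∅} := by
    ext m
    simp only [mem_smallSubsets, Nat.le_zero, card_eq_zero, mem_singleton]
    exact ⟨fun h => h.2, fun h => by simp [h]⟩
  simp [truncProd, this]

lemma truncProd_insert {P : Finset ℕ} {a : ℕ} (ha : a ∉ P) (R : ℕ) (x : ℕ → ℝ) :
    truncProd (insert a P) (R + 1) x = truncProd P (R + 1) x - x a * truncProd P R x := by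
  unfold truncProd smallSubsets
  simp only [Finset.sum_filter]
  rw [Finset.sum_powerset_insert ha, sub_eq_add_neg, ← neg_mul, Finset.mul_sum]
  congr 1
  apply Finset.sum_congr rfl
  intro m hm
  have ham : a ∉ m := fun h => ha (mem_powerset.1 hm h)
  rw [Finset.card_insert_of_notMem ham, Finset.prod_insert ham]
  simp

/-- The Bonferroni inequalities. -/
lemma truncProd_bonferroni (P : Finset ℕ) (x : ℕ → ℝ) (hx : ∀ p ∈ P, 0 ≤ x p ∧ x p ≤ 1) (R : ℕ) :
    0 ≤ (-1) ^ R * (truncProd P R x - ∏ p ∈ P, (1 - x p)) := by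
  induction P using Finset.induction_on generalizing R with
  | empty =>
    have : smallSubsets ∅ R = {∅} := by
      ext m
      simp only [mem_smallSubsets, subset_empty, mem_singleton]
      exact ⟨fun h => h.1, fun h => by simp [h]⟩
    simp [truncProd, this]
  | insert a P ha ih =>
    have hP : ∀ p ∈ P, 0 ≤ x p ∧ x p ≤ 1 := fun p hp => hx p (mem_insert_of_mem hp)
    have hxa := hx a (mem_insert_self a P)
    cases R with
    | zero =>
      rw [truncProd_zero]
      have : ∏ p ∈ insert a P, (1 - x p) ≤ 1 := Finset.prod_le_one
        (fun p hp => by linarith [(hx p hp).2]) (fun p hp => by linarith [(hx p hp).1])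
      linarith
    | succ R =>
      rw [truncProd_insert ha, Finset.prod_insert ha]
      have h1 := ih hP (R + 1)
      have h2 := mul_nonneg hxa.1 (ih hP R)
      rw [pow_succ] at h1 ⊢
      linarith

lemma prod_le_truncProd {P : Finset ℕ} {x : ℕ → ℝ} (hx : ∀ p ∈ P, 0 ≤ x p ∧ x p ≤ 1) {R : ℕ}
    (hR : Even R) : ∏ p ∈ P, (1 - x p) ≤ truncProd P R x := by
  have := truncProd_bonferroni P x hx R
  rw [hR.neg_one_pow] at this
  linarith

lemma sum_powerset_prod (P : Finset ℕ) (g : ℕ → ℝ) :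
    ∑ m ∈ P.powerset, ∏ p ∈ m, g p = ∏ p ∈ P, (1 + g p) := by
  rw [Finset.prod_one_add]

lemma sum_powerset_prod_le (P : Finset ℕ) (g : ℕ → ℝ) (hg : ∀ p ∈ P, 0 ≤ g p) :
    ∑ m ∈ P.powerset, ∏ p ∈ m, g p ≤ Real.exp (∑ p ∈ P, g p) := by
  rw [sum_powerset_prod, Real.exp_sum]
  apply Finset.prod_le_prod
  · intro p hp
    linarith [hg p hp]
  · intro p hp
    rw [add_comm]
    exact Real.add_one_le_exp _

lemma sum_smallSubsets_prod_le (P : Finset ℕ) (R : ℕ) (g : ℕ → ℝ) (hg : ∀ p ∈ P, 0 ≤ g p) :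
    ∑ m ∈ smallSubsets P R, ∏ p ∈ m, g p ≤ Real.exp (∑ p ∈ P, g p) :=
  (Finset.sum_le_sum_of_subset_of_nonneg (Finset.filter_subset _ _)
    (fun _ hm _ => Finset.prod_nonneg fun p hp => hg p (mem_powerset.1 hm hp))).trans
    (sum_powerset_prod_le P g hg)

/-- Rankin's bound for the weighted number of small subsets. -/
lemma sum_smallSubsets_pow_le (P : Finset ℕ) (R : ℕ) {Z c : ℝ} (hZ : 1 ≤ Z) (hP : (#P : ℝ) ≤ Z)
    (hc : 0 ≤ c) : ∑ m ∈ smallSubsets P R, c ^ #m ≤ Real.exp c * Z ^ R := by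
  have hZ0 : 0 < Z := by linarith
  have h1 : ∀ m ∈ smallSubsets P R, c ^ #m ≤ Z ^ R * ∏ _p ∈ m, (c / Z) := by
    intro m hm
    rw [Finset.prod_const, div_pow, mul_div_assoc', le_div_iff₀ (by positivity), mul_comm]
    apply mul_le_mul_of_nonneg_right _ (by positivity)
    exact pow_le_pow_right₀ hZ (mem_smallSubsets.1 hm).2
  refine (Finset.sum_le_sum h1).trans ?_
  rw [← Finset.mul_sum, mul_comm]
  apply mul_le_mul_of_nonneg_right _ (by positivity)
  refine (sum_smallSubsets_prod_le P R _ (fun _ _ => by positivity)).trans ?_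
  apply Real.exp_le_exp.2
  rw [Finset.sum_const, nsmul_eq_mul, mul_div_assoc', div_le_iff₀ hZ0, mul_comm]
  exact mul_le_mul_of_nonneg_left hP hc

lemma truncProd_le {P : Finset ℕ} {R : ℕ} (g : ℕ → ℝ) (hg : ∀ p ∈ P, 0 ≤ g p ∧ g p ≤ 1)
    (hR : 4 * ∑ p ∈ P, g p ≤ R) :
    truncProd P R g ≤ 2 * Real.exp (-∑ p ∈ P, g p) := by
  set G := ∑ p ∈ P, g p with hG
  have hG0 : 0 ≤ G := Finset.sum_nonneg fun p hp => (hg p hp).1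
  have hfull : ∑ m ∈ P.powerset, ∏ p ∈ m, (-g p) = ∏ p ∈ P, (1 - g p) := by
    rw [sum_powerset_prod P (fun p => -g p)]
    simp [sub_eq_add_neg]
  have hsplit := Finset.sum_filter_add_sum_filter_not P.powerset (fun m => #m ≤ R)
    (fun m => ∏ p ∈ m, (-g p))
  have h1 : ∏ p ∈ P, (1 - g p) ≤ Real.exp (-G) := by
    rw [hG, ← Finset.sum_neg_distrib, Real.exp_sum]
    apply Finset.prod_le_prod
    · intro p hp
      linarith [(hg p hp).2]
    · intro p hp
      linarith [Real.add_one_le_exp (-g p)]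
  have h2 : |∑ m ∈ P.powerset.filter (fun m => ¬ #m ≤ R), ∏ p ∈ m, (-g p)|
      ≤ Real.exp (-G) := by
    refine (Finset.abs_sum_le_sum_abs _ _).trans ?_
    have h3 : ∀ m ∈ P.powerset.filter (fun m => ¬ #m ≤ R), |∏ p ∈ m, (-g p)|
        ≤ Real.exp (-R) * ∏ p ∈ m, (Real.exp 1 * g p) := by
      intro m hm
      rw [mem_filter, mem_powerset] at hm
      rw [Finset.abs_prod, Finset.prod_mul_distrib, Finset.prod_const, ← mul_assoc,
        ← Real.exp_nat_mul, ← Real.exp_add]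
      have : ∏ p ∈ m, |-g p| = ∏ p ∈ m, g p := by
        apply Finset.prod_congr rfl
        intro p hp
        rw [abs_neg, abs_of_nonneg (hg p (hm.1 hp)).1]
      rw [this]
      apply le_mul_of_one_le_left (Finset.prod_nonneg fun p hp => (hg p (hm.1 hp)).1)
      apply Real.one_le_exp
      have : (R : ℝ) ≤ #m := by exact_mod_cast (by omega : R ≤ #m)
      linarith
    refine (Finset.sum_le_sum h3).trans ?_
    rw [← Finset.mul_sum]
    have h4 : ∑ m ∈ P.powerset.filter (fun m => ¬ #m ≤ R), ∏ p ∈ m, (Real.exp 1 * g p)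
        ≤ Real.exp (Real.exp 1 * G) := by
      rw [hG, Finset.mul_sum]
      refine (Finset.sum_le_sum_of_subset_of_nonneg (Finset.filter_subset _ _) ?_).trans
        (sum_powerset_prod_le P (fun p => Real.exp 1 * g p) ?_)
      · intro m hm _
        exact Finset.prod_nonneg fun p hp =>
          mul_nonneg (Real.exp_pos _).le (hg p (mem_powerset.1 hm hp)).1
      · intro p hp
        exact mul_nonneg (Real.exp_pos _).le (hg p hp).1
    refine (mul_le_mul_of_nonneg_left h4 (Real.exp_pos _).le).trans ?_
    rw [← Real.exp_add]
    apply Real.exp_le_exp.2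
    have : Real.exp 1 ≤ 3 := by linarith [Real.exp_one_lt_d9]
    nlinarith
  have h5 := abs_le.1 h2
  unfold truncProd smallSubsets
  linarith

/-! ### Sums of periodic functions -/

lemma sum_range_mul_of_periodic {F : ℕ → ℝ} {q : ℕ} (hF : Function.Periodic F q) (k : ℕ) :
    ∑ e ∈ range (q * k), F e = k * ∑ e ∈ range q, F e := by
  induction k with
  | zero => simp
  | succ k ih =>
    rw [mul_add, mul_one, Finset.sum_range_add, ih]
    have : ∀ e, F (q * k + e) = F e := by
      intro e
      rw [add_comm, mul_comm]
      exact hF.nat_mul k e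
    simp only [this]
    push_cast
    ring

lemma abs_sum_range_sub_le {F : ℕ → ℝ} {q : ℕ} (hq : 0 < q) (hF : Function.Periodic F q)
    (h0 : ∀ e, 0 ≤ F e) (M : ℕ) :
    |∑ e ∈ range M, F e - M * ((∑ e ∈ range q, F e) / q)| ≤ ∑ e ∈ range q, F e := by
  set S := ∑ e ∈ range q, F e with hS
  have hq' : (0 : ℝ) < q := by exact_mod_cast hq
  have hS0 : 0 ≤ S := Finset.sum_nonneg fun e _ => h0 e
  have h1 : ∑ e ∈ range M, F e = (M / q : ℕ) * S + ∑ e ∈ range (M % q), F e := by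
    conv_lhs => rw [← Nat.div_add_mod M q]
    rw [Finset.sum_range_add, sum_range_mul_of_periodic hF]
    congr 1
    apply Finset.sum_congr rfl
    intro e _
    rw [add_comm, mul_comm]
    exact hF.nat_mul _ e
  have h2 : ∑ e ∈ range (M % q), F e ≤ S :=
    Finset.sum_le_sum_of_subset_of_nonneg
      (Finset.range_subset_range.2 (Nat.mod_lt _ hq).le) (fun e _ _ => h0 e)
  have h3 : 0 ≤ ∑ e ∈ range (M % q), F e := Finset.sum_nonneg fun e _ => h0 e
  have h4 : (M : ℝ) * (S / q) = (M / q : ℕ) * S + ((M % q : ℕ) / (q : ℝ)) * S := by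
    have : (M : ℝ) = q * (M / q : ℕ) + (M % q : ℕ) := by
      exact_mod_cast (Nat.div_add_mod M q).symm
    conv_lhs => rw [this]
    field_simp
  have h5 : ((M % q : ℕ) / (q : ℝ)) * S ≤ S := by
    apply mul_le_of_le_one_left hS0
    rw [div_le_one hq']
    exact_mod_cast (Nat.mod_lt _ hq).le
  have h6 : 0 ≤ ((M % q : ℕ) / (q : ℝ)) * S := by positivity
  rw [abs_le]
  constructor <;> linarith

lemma sum_range_mul_of_coprime {F G : ℕ → ℝ} {q r : ℕ} (hq : 0 < q) (hr : 0 < r)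
    (hqr : q.Coprime r) (hF : Function.Periodic F q) (hG : Function.Periodic G r) :
    ∑ e ∈ range (q * r), F e * G e = (∑ e ∈ range q, F e) * ∑ e ∈ range r, G e := by
  rw [Finset.sum_mul_sum, ← Finset.sum_product']
  apply Finset.sum_nbij (fun e => (e % q, e % r))
  · intro e _
    simp only [mem_product, mem_range]
    exact ⟨Nat.mod_lt _ hq, Nat.mod_lt _ hr⟩
  · intro a ha b hb hab
    simp only [coe_range, Set.mem_Iio] at ha hb
    simp only [Prod.mk.injEq] at hab
    have h := (Nat.modEq_and_modEq_iff_modEq_mul hqr).1 hab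
    exact Nat.ModEq.eq_of_lt_of_lt h ha hb
  · rintro ⟨a, b⟩ hab
    simp only [coe_product, coe_range, Set.mem_prod, Set.mem_Iio] at hab
    refine ⟨Nat.chineseRemainder hqr a b, ?_, ?_⟩
    · simp only [coe_range, Set.mem_Iio]
      exact Nat.chineseRemainder_lt_mul hqr a b hq.ne' hr.ne'
    · have h := (Nat.chineseRemainder hqr a b).2
      have h1 : _ % q = a % q := h.1
      have h2 : _ % r = b % r := h.2
      ext
      · exact h1.trans (Nat.mod_eq_of_lt hab.1)
      · exact h2.trans (Nat.mod_eq_of_lt hab.2)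
  · intro e _
    simp only [hF.map_mod_nat, hG.map_mod_nat]

lemma periodic_prod {m : Finset ℕ} {x : ℕ → ℕ → ℝ}
    (hper : ∀ p ∈ m, Function.Periodic (x p) p) :
    Function.Periodic (fun e => ∏ p ∈ m, x p e) (∏ p ∈ m, p) := by
  intro e
  apply Finset.prod_congr rfl
  intro p hp
  obtain ⟨k, hk⟩ := Finset.dvd_prod_of_mem (fun p => p) hp
  rw [hk, mul_comm p k]
  exact (hper p hp).nat_mul k e

lemma sum_range_prod {m : Finset ℕ} (hm : ∀ p ∈ m, p.Prime) {x : ℕ → ℕ → ℝ}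
    (hper : ∀ p ∈ m, Function.Periodic (x p) p) :
    ∑ e ∈ range (∏ p ∈ m, p), ∏ p ∈ m, x p e = ∏ p ∈ m, ∑ e ∈ range p, x p e := by
  induction m using Finset.induction_on with
  | empty => simp
  | insert a m ha ih =>
    have hm' : ∀ p ∈ m, p.Prime := fun p hp => hm p (mem_insert_of_mem hp)
    have hper' : ∀ p ∈ m, Function.Periodic (x p) p := fun p hp => hper p (mem_insert_of_mem hp)
    rw [Finset.prod_insert ha, Finset.prod_insert ha, ← ih hm' hper']
    simp_rw [Finset.prod_insert ha]
    apply sum_range_mul_of_coprime (hm a (mem_insert_self a m)).pos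
      (Finset.prod_pos fun p hp => (hm' p hp).pos) _ (hper a (mem_insert_self a m))
      (periodic_prod hper')
    apply Nat.Coprime.prod_right
    intro p hp
    rw [Nat.coprime_primes (hm a (mem_insert_self a m)) (hm' p hp)]
    rintro rfl
    exact ha hp

/-- Brun's pure sieve: an upper bound for the truncated inclusion-exclusion sum. -/
lemma sum_truncProd_le {P : Finset ℕ} (hP : ∀ p ∈ P, p.Prime) {Z : ℝ} (hZ : 1 ≤ Z)
    (hPZ : (#P : ℝ) ≤ Z) {R : ℕ} {x : ℕ → ℕ → ℝ} (hx : ∀ p ∈ P, ∀ e, 0 ≤ x p e)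
    (hper : ∀ p ∈ P, Function.Periodic (x p) p) (g : ℕ → ℝ)
    (hg : ∀ p ∈ P, ∑ e ∈ range p, x p e = p * g p)
    (hg1 : ∀ p ∈ P, g p ≤ 1) (hg2 : ∀ p ∈ P, p * g p ≤ 2)
    (hR : 4 * ∑ p ∈ P, g p ≤ R) (M : ℕ) :
    ∑ e ∈ range M, truncProd P R (fun p => x p e)
      ≤ 2 * M * Real.exp (-∑ p ∈ P, g p) + 8 * Z ^ R := by
  have hg0 : ∀ p ∈ P, 0 ≤ g p := by
    intro p hp
    have h1 : 0 ≤ (p : ℝ) * g p := by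
      rw [← hg p hp]
      exact Finset.sum_nonneg fun e _ => hx p hp e
    have h2 : (0 : ℝ) < p := by exact_mod_cast (hP p hp).pos
    exact nonneg_of_mul_nonneg_right h1 h2
  have hmain : ∀ m ∈ smallSubsets P R, ∑ e ∈ range M, ∏ p ∈ m, (-x p e)
      ≤ M * ∏ p ∈ m, (-g p) + 2 ^ #m := by
    intro m hm
    have hmP := (mem_smallSubsets.1 hm).1
    have h1 := abs_sum_range_sub_le (Finset.prod_pos fun p hp => (hP p (hmP hp)).pos)
      (periodic_prod fun p hp => hper p (hmP hp))
      (fun e => Finset.prod_nonneg fun p hp => hx p (hmP hp) e) M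
    rw [sum_range_prod (fun p hp => hP p (hmP hp)) (fun p hp => hper p (hmP hp))] at h1
    have h2 : ∏ p ∈ m, ∑ e ∈ range p, x p e = ∏ p ∈ m, (p * g p) :=
      Finset.prod_congr rfl fun p hp => hg p (hmP hp)
    rw [h2] at h1
    have h3 : (∏ p ∈ m, (p * g p)) / ((∏ p ∈ m, p : ℕ) : ℝ) = ∏ p ∈ m, g p := by
      push_cast
      rw [Finset.prod_mul_distrib, mul_div_cancel_left₀]
      exact Finset.prod_ne_zero_iff.2 fun p hp => by
        exact_mod_cast (hP p (hmP hp)).ne_zero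
    rw [h3] at h1
    have h4 : ∏ p ∈ m, (p * g p) ≤ 2 ^ #m := by
      rw [← Finset.prod_const]
      exact Finset.prod_le_prod (fun p hp => mul_nonneg (by positivity) (hg0 p (hmP hp)))
        (fun p hp => hg2 p (hmP hp))
    have h5 := abs_le.1 (h1.trans h4)
    simp only [Finset.prod_neg]
    rw [← Finset.mul_sum]
    rcases neg_one_pow_eq_or ℝ #m with h | h <;> rw [h] <;> linarith
  calc ∑ e ∈ range M, truncProd P R (fun p => x p e)
      = ∑ m ∈ smallSubsets P R, ∑ e ∈ range M, ∏ p ∈ m, (-x p e) := by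
        unfold truncProd
        rw [Finset.sum_comm]
    _ ≤ ∑ m ∈ smallSubsets P R, (M * ∏ p ∈ m, (-g p) + 2 ^ #m) := Finset.sum_le_sum hmain
    _ = M * truncProd P R g + ∑ m ∈ smallSubsets P R, (2 : ℝ) ^ #m := by
        rw [Finset.sum_add_distrib, ← Finset.mul_sum, truncProd]
    _ ≤ M * (2 * Real.exp (-∑ p ∈ P, g p)) + 8 * Z ^ R := by
        apply add_le_add
        · exact mul_le_mul_of_nonneg_left
            (truncProd_le g (fun p hp => ⟨hg0 p hp, hg1 p hp⟩) hR) (by positivity)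
        · refine (sum_smallSubsets_pow_le P R hZ hPZ (by norm_num)).trans ?_
          apply mul_le_mul_of_nonneg_right _ (by positivity)
          have h := Real.exp_one_lt_d9
          have h' := Real.exp_pos 1
          have : Real.exp 2 = Real.exp 1 * Real.exp 1 := by
            rw [← Real.exp_add]; norm_num
          rw [this]
          nlinarith
    _ = _ := by ring

/-- Brun's pure sieve: an upper bound for a sum of products of local weights. -/
lemma sum_prod_one_sub_le {P : Finset ℕ} (hP : ∀ p ∈ P, p.Prime) {Z : ℝ} (hZ : 1 ≤ Z)
    (hPZ : (#P : ℝ) ≤ Z) {R : ℕ} (hReven : Even R) {x : ℕ → ℕ → ℝ}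
    (hx : ∀ p ∈ P, ∀ e, 0 ≤ x p e ∧ x p e ≤ 1)
    (hper : ∀ p ∈ P, Function.Periodic (x p) p) (g : ℕ → ℝ)
    (hg : ∀ p ∈ P, ∑ e ∈ range p, x p e = p * g p)
    (hg1 : ∀ p ∈ P, g p ≤ 1) (hg2 : ∀ p ∈ P, p * g p ≤ 2)
    (hR : 4 * ∑ p ∈ P, g p ≤ R) (M : ℕ) :
    ∑ e ∈ range M, ∏ p ∈ P, (1 - x p e)
      ≤ 2 * M * Real.exp (-∑ p ∈ P, g p) + 8 * Z ^ R :=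
  (Finset.sum_le_sum fun e _ => prod_le_truncProd (fun p hp => hx p hp e) hReven).trans
    (sum_truncProd_le hP hZ hPZ (fun p hp e => (hx p hp e).1) hper g hg hg1 hg2 hR M)

/-! ### Character sums -/

lemma chi4_mul (m n : ℕ) : chi4 (m * n) = chi4 m * chi4 n := by
  unfold chi4
  rw [Nat.mul_mod]
  have hm : m % 4 < 4 := Nat.mod_lt _ (by norm_num)
  have hn : n % 4 < 4 := Nat.mod_lt _ (by norm_num)
  interval_cases m % 4 <;> interval_cases n % 4 <;> norm_num

lemma abs_chi4_le_one (n : ℕ) : |chi4 n| ≤ 1 := by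
  unfold chi4
  split_ifs <;> simp

lemma chi4_periodic : Function.Periodic chi4 4 := by
  intro n
  simp [chi4]

lemma sum_chi4 : ∑ a ∈ range 4, chi4 a = 0 := by
  simp [Finset.sum_range_succ, chi4]

/-- The indicator function of `ν ∣ k * a + c`. -/
def dvdInd (ν k c a : ℕ) : ℝ := if ν ∣ k * a + c then 1 else 0

lemma dvdInd_nonneg (ν k c a : ℕ) : 0 ≤ dvdInd ν k c a := by
  unfold dvdInd; split_ifs <;> simp

lemma dvdInd_periodic (ν k c : ℕ) : Function.Periodic (dvdInd ν k c) ν := by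
  intro a
  unfold dvdInd
  have : k * (a + ν) + c = k * a + c + ν * k := by ring
  rw [this]
  simp only [Nat.dvd_add_left (dvd_mul_right ν k)]

lemma sum_dvdInd_of_coprime {ν k : ℕ} (hν : 0 < ν) (hk : ν.Coprime k) (c : ℕ) :
    ∑ a ∈ range ν, dvdInd ν k c a = 1 := by
  unfold dvdInd
  rw [Finset.sum_ite, Finset.sum_const_zero, add_zero, Finset.sum_const, nsmul_eq_mul, mul_one]
  norm_cast
  rw [Finset.card_eq_one]
  obtain ⟨u, huν, hu⟩ := Nat.exists_mul_mod_eq_of_coprime (ν * c - c) hk.symm hν.ne'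
  have hc : c ≤ ν * c := Nat.le_mul_of_pos_left c hν
  refine ⟨u, ?_⟩
  ext a
  simp only [mem_filter, mem_range, mem_singleton]
  have hu' : ν ∣ k * u + c := by
    have h1 : k * u + c ≡ (ν * c - c) + c [MOD ν] := Nat.ModEq.add_right c hu
    rw [Nat.sub_add_cancel hc] at h1
    exact (Nat.modEq_zero_iff_dvd.1 (h1.trans (Nat.modEq_zero_iff_dvd.2 (dvd_mul_right ν c))))
  constructor
  · rintro ⟨ha, hd⟩
    have h1 : k * a + c ≡ k * u + c [MOD ν] :=
      (Nat.modEq_zero_iff_dvd.2 hd).trans (Nat.modEq_zero_iff_dvd.2 hu').symm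
    have h2 := Nat.ModEq.cancel_left_of_coprime hk (Nat.ModEq.add_right_cancel' c h1)
    exact Nat.ModEq.eq_of_lt_of_lt h2 ha huν
  · rintro rfl
    exact ⟨huν, hu'⟩

lemma sum_dvdInd_le_one {ν k : ℕ} (hν : 0 < ν) :
    ∑ a ∈ range ν, dvdInd ν k 1 a ≤ 1 := by
  by_cases hk : ν.Coprime k
  · exact (sum_dvdInd_of_coprime hν hk 1).le
  · have : ∀ a ∈ range ν, dvdInd ν k 1 a = 0 := by
      intro a _
      unfold dvdInd
      rw [if_neg]
      intro h
      apply hk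
      have h1 : ν.gcd k ∣ k * a := (Nat.gcd_dvd_right ν k).mul_right a
      have h2 := (Nat.dvd_add_right h1).1 ((Nat.gcd_dvd_left ν k).trans h)
      exact Nat.dvd_one.1 h2
    rw [Finset.sum_congr rfl this]
    simp

lemma abs_sum_chi4_dvdInd_le {ν : ℕ} (hν : Odd ν) (k M : ℕ) :
    |∑ a ∈ range M, chi4 a * dvdInd ν k 1 a| ≤ 4 := by
  have hν0 : 0 < ν := hν.pos
  have hcop : Nat.Coprime 4 ν := by
    have : Nat.Coprime 2 ν := (Nat.coprime_two_left).2 hν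
    exact Nat.Coprime.pow_left 2 this
  have hper : Function.Periodic (fun a => chi4 a * dvdInd ν k 1 a) (4 * ν) := by
    intro a
    have h1 : chi4 (a + 4 * ν) = chi4 a := by
      rw [mul_comm]; exact chi4_periodic.nat_mul ν a
    have h2 : dvdInd ν k 1 (a + 4 * ν) = dvdInd ν k 1 a := (dvdInd_periodic ν k 1).nat_mul 4 a
    simp only [h1, h2]
  have hfull := sum_range_mul_of_coprime (by norm_num) hν0 hcop chi4_periodic
    (dvdInd_periodic ν k 1)
  rw [sum_chi4, zero_mul] at hfull
  have h1 : ∑ a ∈ range M, chi4 a * dvdInd ν k 1 a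
      = ∑ a ∈ range (M % (4 * ν)), chi4 a * dvdInd ν k 1 a := by
    conv_lhs => rw [← Nat.div_add_mod M (4 * ν)]
    rw [Finset.sum_range_add, sum_range_mul_of_periodic hper, hfull, mul_zero, zero_add]
    apply Finset.sum_congr rfl
    intro a _
    rw [add_comm, mul_comm (4 * ν)]
    exact hper.nat_mul _ a
  rw [h1]
  calc |∑ a ∈ range (M % (4 * ν)), chi4 a * dvdInd ν k 1 a|
      ≤ ∑ a ∈ range (M % (4 * ν)), dvdInd ν k 1 a := by
        refine (Finset.abs_sum_le_sum_abs _ _).trans (Finset.sum_le_sum fun a _ => ?_)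
        rw [abs_mul, abs_of_nonneg (dvdInd_nonneg _ _ _ _)]
        exact mul_le_of_le_one_left (dvdInd_nonneg _ _ _ _) (abs_chi4_le_one a)
    _ ≤ ∑ a ∈ range (ν * 4), dvdInd ν k 1 a := by
        apply Finset.sum_le_sum_of_subset_of_nonneg
        · apply Finset.range_subset_range.2
          rw [mul_comm ν 4]
          exact (Nat.mod_lt _ (by omega)).le
        · intro a _ _
          exact dvdInd_nonneg _ _ _ _
    _ = 4 * ∑ a ∈ range ν, dvdInd ν k 1 a := by
        rw [sum_range_mul_of_periodic (dvdInd_periodic ν k 1)]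
        norm_num
    _ ≤ 4 := by linarith [sum_dvdInd_le_one (k := k) hν0]

lemma sum_moebius_dvd {q : ℕ} (hq : q ≠ 0) (a : ℕ) :
    ∑ c ∈ q.divisors, (if c ∣ a then (ArithmeticFunction.moebius c : ℝ) else 0)
      = if a.Coprime q then 1 else 0 := by
  rw [← Finset.sum_filter]
  have : q.divisors.filter (fun c => c ∣ a) = (a.gcd q).divisors := by
    ext c
    simp only [mem_filter, Nat.mem_divisors, Nat.dvd_gcd_iff]
    have : a.gcd q ≠ 0 := Nat.gcd_ne_zero_right hq
    tauto
  rw [this]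
  have h := congrArg (fun f => f (a.gcd q)) (ArithmeticFunction.coe_moebius_mul_coe_zeta (R := ℝ))
  simp only [ArithmeticFunction.coe_mul_zeta_apply,
    ArithmeticFunction.one_apply, ArithmeticFunction.intCoe_apply] at h
  exact h

lemma sum_range_dvd {c : ℕ} (hc : 0 < c) (M : ℕ) (f : ℕ → ℝ) :
    ∑ a ∈ range M, (if c ∣ a then f a else 0) = ∑ a ∈ range ((M + c - 1) / c), f (c * a) := by
  rw [← Finset.sum_filter]
  symm
  apply Finset.sum_nbij (fun a => c * a)
  · intro a ha
    rw [mem_range] at ha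
    simp only [mem_filter, mem_range, dvd_mul_right, and_true]
    have h1 := (Nat.le_div_iff_mul_le hc).1 (Nat.succ_le_of_lt ha)
    have : (a + 1) * c = c * a + c := by ring
    rw [Nat.succ_eq_add_one] at h1
    omega
  · intro a _ b _ hab
    exact Nat.eq_of_mul_eq_mul_left hc hab
  · intro a ha
    simp only [coe_filter, mem_range, Set.mem_ofPred_eq] at ha
    obtain ⟨h1, b, rfl⟩ := ha
    refine ⟨b, ?_, rfl⟩
    simp only [coe_range, Set.mem_Iio]
    rw [← Nat.succ_le_iff, Nat.le_div_iff_mul_le hc]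
    have : b.succ * c = c * b + c := by rw [Nat.succ_eq_add_one]; ring
    omega
  · intro a _
    rfl

/-- A character sum over integers coprime to `q` in a residue class to an odd modulus. -/
lemma abs_sum_chi4_coprime_le {ν : ℕ} (hν : Odd ν) (k : ℕ) {q : ℕ} (hq : q ≠ 0) (M : ℕ) :
    |∑ a ∈ range M, chi4 a * (if a.Coprime q then 1 else 0) * dvdInd ν k 1 a|
      ≤ 4 * #q.divisors := by
  have h1 : ∑ a ∈ range M, chi4 a * (if a.Coprime q then 1 else 0) * dvdInd ν k 1 a
      = ∑ c ∈ q.divisors, (ArithmeticFunction.moebius c : ℝ) * chi4 c *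
        ∑ a ∈ range ((M + c - 1) / c), chi4 a * dvdInd ν (k * c) 1 a := by
    simp_rw [← sum_moebius_dvd hq, Finset.mul_sum, Finset.sum_mul]
    rw [Finset.sum_comm]
    apply Finset.sum_congr rfl
    intro c hc
    have hc0 : 0 < c := Nat.pos_of_mem_divisors hc
    have := sum_range_dvd hc0 M
      (fun a => (ArithmeticFunction.moebius c : ℝ) * chi4 a * dvdInd ν k 1 a)
    calc _ = ∑ a ∈ range M, (if c ∣ a then
          (ArithmeticFunction.moebius c : ℝ) * chi4 a * dvdInd ν k 1 a else 0) := by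
          apply Finset.sum_congr rfl
          intro a _
          split_ifs <;> ring
      _ = _ := by
          rw [this]
          apply Finset.sum_congr rfl
          intro a _
          have : dvdInd ν k 1 (c * a) = dvdInd ν (k * c) 1 a := by
            unfold dvdInd; rw [mul_assoc]
          rw [chi4_mul, this]
          ring
  rw [h1]
  refine (Finset.abs_sum_le_sum_abs _ _).trans ?_
  rw [mul_comm, ← nsmul_eq_mul]
  apply Finset.sum_le_card_nsmul
  intro c _
  rw [abs_mul, abs_mul]
  have h2 : |(ArithmeticFunction.moebius c : ℝ)| ≤ 1 := by
    exact_mod_cast ArithmeticFunction.abs_moebius_le_one (n := c)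
  have h3 := abs_chi4_le_one c
  have h4 := abs_sum_chi4_dvdInd_le hν (k * c) ((M + c - 1) / c)
  have h5 : |(ArithmeticFunction.moebius c : ℝ)| * |chi4 c| ≤ 1 :=
    mul_le_one₀ h2 (abs_nonneg _) h3
  calc _ ≤ 1 * 4 := mul_le_mul h5 h4 (abs_nonneg _) (by norm_num)
    _ = 4 := by norm_num

/-! ### Sums over order-convex sets -/

lemma eq_Icc_of_convex {s : Finset ℕ} (hs : s.Nonempty)
    (hconv : ∀ x ∈ s, ∀ y ∈ s, ∀ z, x ≤ z → z ≤ y → z ∈ s) : s = Icc (s.min' hs) (s.max' hs) := by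
  ext z
  rw [mem_Icc]
  constructor
  · intro hz
    exact ⟨s.min'_le z hz, s.le_max' z hz⟩
  · intro hz
    exact hconv _ (s.min'_mem hs) _ (s.max'_mem hs) z hz.1 hz.2

lemma sum_Icc_eq_sub (f : ℕ → ℝ) {m n : ℕ} (h : m ≤ n + 1) :
    ∑ a ∈ Icc m n, f a = ∑ a ∈ range (n + 1), f a - ∑ a ∈ range m, f a := by
  rw [← Finset.sum_Ico_eq_sub _ h]
  rfl

/-- Partial summation against a nonincreasing nonnegative weight. -/
lemma abs_sum_mul_antitone_le {f w : ℕ → ℝ} {B W : ℝ}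
    (hf : ∀ n, |∑ a ∈ range n, f a| ≤ B) {s : Finset ℕ}
    (hconv : ∀ x ∈ s, ∀ y ∈ s, ∀ z, x ≤ z → z ≤ y → z ∈ s)
    (hw : ∀ x ∈ s, ∀ n, x ≤ n → w (n + 1) ≤ w n) (hw0 : ∀ x ∈ s, ∀ n, x ≤ n → 0 ≤ w n)
    (hW : ∀ x ∈ s, w x ≤ W) (hW0 : 0 ≤ W) :
    |∑ a ∈ s, f a * w a| ≤ 2 * B * W := by
  have hB : 0 ≤ B := (abs_nonneg _).trans (hf 0)
  rcases s.eq_empty_or_nonempty with rfl | hs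
  · simp; positivity
  set m := s.min' hs with hm
  set n := s.max' hs with hn
  have hms : m ∈ s := s.min'_mem hs
  have hmn : m ≤ n := s.min'_le n (s.max'_mem hs)
  have hsum : ∀ g : ℕ → ℝ, ∑ a ∈ s, g a = ∑ a ∈ Icc m n, g a := by
    intro g
    rw [← eq_Icc_of_convex hs hconv]
  rw [hsum]
  have key : ∀ h : ℕ → ℝ, (∀ n, |∑ a ∈ range n, h a| ≤ B) →
      ∑ a ∈ Icc m n, h a * w a ≤ 2 * B * W := by
    intro h hh
    have h1 : ∀ k, m ≤ k → ∑ a ∈ Icc m k, (if a = m then 2 * B else 0) = 2 * B := by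
      intro k hk
      rw [Finset.sum_ite_eq' (Icc m k) m, if_pos (mem_Icc.2 ⟨le_rfl, hk⟩)]
    have h2 : ∀ k, m ≤ k → 0 ≤ ∑ a ∈ Icc m k, ((if a = m then 2 * B else 0) - h a) := by
      intro k hk
      rw [Finset.sum_sub_distrib, h1 k hk, sum_Icc_eq_sub h (by omega)]
      have a1 := abs_le.1 (hh (k + 1))
      have a2 := abs_le.1 (hh m)
      linarith
    have h3 := sum_mul_antitone_nonneg h2 (hw m hms) n hmn
    have h4 := mul_nonneg (h2 n hmn) (hw0 m hms n hmn)
    have h5 : ∑ a ∈ Icc m n, (if a = m then 2 * B else 0) * w a = 2 * B * w m := by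
      simp_rw [ite_mul, zero_mul]
      rw [Finset.sum_ite_eq' (Icc m n) m, if_pos (mem_Icc.2 ⟨le_rfl, hmn⟩)]
    simp only [sub_mul, Finset.sum_sub_distrib] at h3 h4
    rw [h5] at h3
    have h6 : 2 * B * w m ≤ 2 * B * W :=
      mul_le_mul_of_nonneg_left (hW m hms) (by positivity)
    linarith
  rw [abs_le]
  constructor
  · have := key (fun a => -f a) (by
      intro n
      rw [Finset.sum_neg_distrib, abs_neg]
      exact hf n)
    simp only [neg_mul, Finset.sum_neg_distrib] at this
    linarith
  · exact key f hf

lemma abs_sum_convex_le {f : ℕ → ℝ} {B : ℝ}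
    (hf : ∀ n, |∑ a ∈ range n, f a| ≤ B) {s : Finset ℕ}
    (hconv : ∀ x ∈ s, ∀ y ∈ s, ∀ z, x ≤ z → z ≤ y → z ∈ s) :
    |∑ a ∈ s, f a| ≤ 2 * B := by
  have := abs_sum_mul_antitone_le (w := fun _ => 1) (W := 1) hf hconv (by simp) (by simp)
    (by simp) (by simp)
  simpa using this

/-! ### The sieve weights -/

/-- The indicator function of `ν ∣ n`. -/
def dvdOne (ν n : ℕ) : ℝ := if ν ∣ n then 1 else 0

lemma dvdOne_nonneg (ν n : ℕ) : 0 ≤ dvdOne ν n := by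
  unfold dvdOne; split_ifs <;> simp

lemma dvdOne_le_one (ν n : ℕ) : dvdOne ν n ≤ 1 := by
  unfold dvdOne; split_ifs <;> simp

lemma dvdOne_eq_one {ν n : ℕ} (h : ν ∣ n) : dvdOne ν n = 1 := if_pos h

lemma dvdOne_eq_zero {ν n : ℕ} (h : ¬ ν ∣ n) : dvdOne ν n = 0 := if_neg h

/-- The indicator function of the integers `n` with `n + 1` free of prime factors from `P`. -/
def sifted (P : Finset ℕ) (n : ℕ) : ℝ := ∏ p ∈ P, (1 - dvdOne p (n + 1))

/-- The Brun upper bound weight for `sifted`. -/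
def brun (P : Finset ℕ) (R n : ℕ) : ℝ := truncProd P R (fun p => dvdOne p (n + 1))

/-- The weight `(3/4) ^ #{p ∈ P : p ∣ n}`. -/
def thin (P : Finset ℕ) (n : ℕ) : ℝ := ∏ p ∈ P, (1 - 1 / 4 * dvdOne p n)

/-- The sum of the reciprocals of the elements of `P`. -/
def recipSum (P : Finset ℕ) : ℝ := ∑ p ∈ P, (1 : ℝ) / p

/-- A set `P` of odd primes with a truncation level `R`, suitable for the sieve of integers up to
`X`, the constant `E` bounding the loss from primes dividing a given integer. -/
structure SieveRange (P : Finset ℕ) (R : ℕ) (Z E : ℝ) (X : ℕ) : Prop where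
  prime : ∀ p ∈ P, p.Prime
  odd : ∀ p ∈ P, Odd p
  one_le : 1 ≤ Z
  card_le : (#P : ℝ) ≤ Z
  even : Even R
  le_level : 8 * recipSum P ≤ R
  one_le_loss : 1 ≤ E
  loss : ∀ c, 1 ≤ c → c ≤ X → Real.exp (2 * ∑ p ∈ P, 1 / (p : ℝ) * dvdOne p c) ≤ E

lemma sifted_nonneg (P : Finset ℕ) (n : ℕ) : 0 ≤ sifted P n :=
  Finset.prod_nonneg fun p _ => by linarith [dvdOne_le_one p (n + 1)]

lemma thin_nonneg (P : Finset ℕ) (n : ℕ) : 0 ≤ thin P n :=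
  Finset.prod_nonneg fun p _ => by linarith [dvdOne_le_one p n]

lemma sifted_le_brun (P : Finset ℕ) {R : ℕ} (hR : Even R) (n : ℕ) : sifted P n ≤ brun P R n :=
  prod_le_truncProd (fun p _ => ⟨dvdOne_nonneg p _, dvdOne_le_one p _⟩) hR

lemma sum_Icc_one (f : ℕ → ℝ) (M : ℕ) : ∑ e ∈ Icc 1 M, f e = ∑ e ∈ range M, f (e + 1) := by
  induction M with
  | zero => simp
  | succ M ih => rw [Finset.sum_Icc_succ_top (by omega), ih, Finset.sum_range_succ]

lemma recipSum_nonneg (P : Finset ℕ) : 0 ≤ recipSum P :=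
  Finset.sum_nonneg fun p _ => by positivity

lemma sum_coprime_recip (P : Finset ℕ) (κ : ℝ) (c : ℕ) :
    ∑ p ∈ P, κ / p * (1 - dvdOne p c)
      = κ * recipSum P - κ * ∑ p ∈ P, 1 / (p : ℝ) * dvdOne p c := by
  rw [recipSum, Finset.mul_sum, Finset.mul_sum, ← Finset.sum_sub_distrib]
  apply Finset.sum_congr rfl
  intro p _
  ring

lemma SieveRange.exp_le {P : Finset ℕ} {R : ℕ} {Z E : ℝ} {X : ℕ} (h : SieveRange P R Z E X)
    {κ : ℝ} (hκ2 : κ ≤ 2) {c : ℕ} (hc : 1 ≤ c) (hcX : c ≤ X) :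
    Real.exp (-∑ p ∈ P, κ / p * (1 - dvdOne p c)) ≤ Real.exp (-(κ * recipSum P)) * E := by
  rw [sum_coprime_recip]
  have h0 : 0 ≤ ∑ p ∈ P, 1 / (p : ℝ) * dvdOne p c :=
    Finset.sum_nonneg fun p _ => mul_nonneg (by positivity) (dvdOne_nonneg _ _)
  refine le_trans ?_ (mul_le_mul_of_nonneg_left (h.loss c hc hcX) (Real.exp_pos _).le)
  rw [← Real.exp_add]
  apply Real.exp_le_exp.2
  nlinarith

lemma sum_dvdOne_mul_add {p c : ℕ} (hp : p.Prime) :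
    ∑ e ∈ range p, dvdOne p (c * (e + 1) + 1) = 1 - dvdOne p c := by
  have h : ∀ e, dvdOne p (c * (e + 1) + 1) = dvdInd p c (c + 1) e := by
    intro e
    unfold dvdOne dvdInd
    rw [mul_add, mul_one, add_assoc]
  by_cases hpc : p ∣ c
  · rw [dvdOne_eq_one hpc, sub_self]
    apply Finset.sum_eq_zero
    intro e _
    apply dvdOne_eq_zero
    intro hd
    have h1 : p ∣ c * (e + 1) := hpc.mul_right _
    exact hp.one_lt.ne' (Nat.dvd_one.1 ((Nat.dvd_add_right h1).1 hd))
  · simp only [h]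
    rw [sum_dvdInd_of_coprime hp.pos ((Nat.Prime.coprime_iff_not_dvd hp).2 hpc),
      dvdOne_eq_zero hpc, sub_zero]

lemma dvdOne_mul_add_periodic (p c : ℕ) :
    Function.Periodic (fun e => dvdOne p (c * (e + 1) + 1)) p := by
  have h : (fun e => dvdOne p (c * (e + 1) + 1)) = dvdInd p c (c + 1) := by
    ext e
    unfold dvdOne dvdInd
    rw [mul_add, mul_one, add_assoc]
  rw [h]
  exact dvdInd_periodic p c (c + 1)

lemma sum_dvdOne_succ {p : ℕ} (hp : p.Prime) : ∑ e ∈ range p, dvdOne p (e + 1) = 1 := by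
  have h : ∀ e, dvdOne p (e + 1) = dvdInd p 1 1 e := by
    intro e
    unfold dvdOne dvdInd
    rw [one_mul]
  simp only [h]
  exact sum_dvdInd_of_coprime hp.pos (Nat.coprime_one_right p) 1

lemma dvdOne_succ_periodic (p : ℕ) : Function.Periodic (fun e => dvdOne p (e + 1)) p := by
  have h : (fun e => dvdOne p (e + 1)) = dvdInd p 1 1 := by
    ext e
    unfold dvdOne dvdInd
    rw [one_mul]
  rw [h]
  exact dvdInd_periodic p 1 1

lemma kappa_div_le {p : ℕ} (hp : p.Prime) {κ : ℝ} (hκ : κ ≤ 2) (c : ℕ) :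
    κ / p * (1 - dvdOne p c) ≤ 1 ∧ p * (κ / p * (1 - dvdOne p c)) = κ * (1 - dvdOne p c) := by
  have h2 : (2 : ℝ) ≤ p := by exact_mod_cast hp.two_le
  have h0 : (0 : ℝ) < p := by linarith
  have h1 := dvdOne_le_one p c
  have h1' := dvdOne_nonneg p c
  refine ⟨?_, ?_⟩
  · have h3 : κ / p ≤ 1 := by rw [div_le_one h0]; linarith
    nlinarith
  · field_simp

lemma level_le {P : Finset ℕ} {R : ℕ} (hR : 8 * recipSum P ≤ R) {κ : ℝ} (hκ : 0 ≤ κ) (hκ2 : κ ≤ 2)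
    (c : ℕ) : 4 * ∑ p ∈ P, κ / p * (1 - dvdOne p c) ≤ R := by
  rw [sum_coprime_recip]
  have h0 : 0 ≤ ∑ p ∈ P, 1 / (p : ℝ) * dvdOne p c :=
    Finset.sum_nonneg fun p _ => mul_nonneg (by positivity) (dvdOne_nonneg _ _)
  have h1 := recipSum_nonneg P
  nlinarith [mul_nonneg hκ h0]

/-- The sieve bound for the values `c * e + 1`. -/
lemma SieveRange.sum_brun_le {P : Finset ℕ} {R : ℕ} {Z E : ℝ} {X : ℕ} (h : SieveRange P R Z E X)
    {c : ℕ} (hc : 1 ≤ c) (hcX : c ≤ X) (M : ℕ) :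
    ∑ e ∈ Icc 1 M, brun P R (c * e)
      ≤ 2 * M * (Real.exp (-recipSum P) * E) + 8 * Z ^ R := by
  rw [sum_Icc_one]
  unfold brun
  refine (sum_truncProd_le h.prime h.one_le h.card_le
    (x := fun p e => dvdOne p (c * (e + 1) + 1)) (fun p _ e => dvdOne_nonneg _ _)
    (fun p _ => dvdOne_mul_add_periodic p c) (fun p => 1 / p * (1 - dvdOne p c)) ?_ ?_ ?_
    (level_le h.le_level zero_le_one one_le_two c) M).trans ?_
  · intro p hp
    rw [sum_dvdOne_mul_add (h.prime p hp), (kappa_div_le (h.prime p hp) one_le_two c).2, one_mul]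
  · intro p hp
    exact (kappa_div_le (h.prime p hp) one_le_two c).1
  · intro p hp
    rw [(kappa_div_le (h.prime p hp) one_le_two c).2]
    linarith [dvdOne_nonneg p c]
  · have := h.exp_le one_le_two hc hcX
    rw [one_mul] at this
    gcongr

/-- The sieve bound with the additional weight `3/4` for each prime factor from `P`. -/
lemma SieveRange.sum_sifted_thin_le {P : Finset ℕ} {R : ℕ} {Z E : ℝ} {X : ℕ}
    (h : SieveRange P R Z E X) {d : ℕ} (hd : 1 ≤ d) (hdX : d ≤ X) (M : ℕ) :
    ∑ e ∈ Icc 1 M, sifted P (d * e) * thin P (d * e)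
      ≤ thin P d * (2 * M * (Real.exp (-(5 / 4 * recipSum P)) * E) + 8 * Z ^ R) := by
  set x : ℕ → ℕ → ℝ := fun p e =>
    (1 - dvdOne p d) * (1 / 4 * dvdOne p (e + 1)) + dvdOne p (d * (e + 1) + 1) with hx
  have hloc : ∀ p ∈ P, ∀ e, (1 - dvdOne p (d * (e + 1) + 1)) * (1 - 1 / 4 * dvdOne p (d * (e + 1)))
      = (1 - 1 / 4 * dvdOne p d) * (1 - x p e) ∧ 0 ≤ x p e ∧ x p e ≤ 1 := by
    intro p hp e
    have hpp := h.prime p hp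
    have hex : ∀ n, p ∣ n → ¬ p ∣ n + 1 := fun n hn hn1 =>
      hpp.one_lt.ne' (Nat.dvd_one.1 ((Nat.dvd_add_right hn).1 hn1))
    simp only [hx]
    by_cases h1 : p ∣ d
    · have h2 : p ∣ d * (e + 1) := h1.mul_right _
      rw [dvdOne_eq_one h1, dvdOne_eq_one h2, dvdOne_eq_zero (hex _ h2)]
      norm_num
    · by_cases h2 : p ∣ e + 1
      · have h3 : p ∣ d * (e + 1) := h2.mul_left _
        rw [dvdOne_eq_zero h1, dvdOne_eq_one h2, dvdOne_eq_one h3, dvdOne_eq_zero (hex _ h3)]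
        norm_num
      · have h3 : ¬ p ∣ d * (e + 1) := fun h4 => (hpp.dvd_mul.1 h4).elim h1 h2
        rw [dvdOne_eq_zero h1, dvdOne_eq_zero h2, dvdOne_eq_zero h3]
        have := dvdOne_nonneg p (d * (e + 1) + 1)
        have := dvdOne_le_one p (d * (e + 1) + 1)
        norm_num
        constructor <;> linarith
  have hstep : ∑ e ∈ Icc 1 M, sifted P (d * e) * thin P (d * e)
      = thin P d * ∑ e ∈ range M, ∏ p ∈ P, (1 - x p e) := by
    rw [sum_Icc_one, Finset.mul_sum]
    apply Finset.sum_congr rfl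
    intro e _
    unfold sifted thin
    rw [← Finset.prod_mul_distrib, ← Finset.prod_mul_distrib]
    exact Finset.prod_congr rfl fun p hp => (hloc p hp e).1
  rw [hstep]
  apply mul_le_mul_of_nonneg_left _ (thin_nonneg P d)
  refine (sum_prod_one_sub_le h.prime h.one_le h.card_le h.even
    (fun p hp e => (hloc p hp e).2) ?_ (fun p => (5 / 4) / p * (1 - dvdOne p d)) ?_ ?_ ?_
    (level_le h.le_level (by norm_num) (by norm_num) d) M).trans ?_
  · intro p _ e
    have h1 := dvdOne_succ_periodic p e
    have h2 := dvdOne_mul_add_periodic p d e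
    simp only at h1 h2
    simp only [hx, h1, h2]
  · intro p hp
    rw [(kappa_div_le (h.prime p hp) (by norm_num) d).2]
    simp only [hx]
    rw [Finset.sum_add_distrib, ← Finset.mul_sum, ← Finset.mul_sum, sum_dvdOne_succ (h.prime p hp),
      sum_dvdOne_mul_add (h.prime p hp)]
    ring
  · intro p hp
    exact (kappa_div_le (h.prime p hp) (by norm_num) d).1
  · intro p hp
    rw [(kappa_div_le (h.prime p hp) (by norm_num) d).2]
    linarith [dvdOne_nonneg p d]
  · have := h.exp_le (κ := 5 / 4) (by norm_num) hd hdX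
    gcongr

/-- The mean value of `thin`. -/
lemma SieveRange.sum_thin_le {P : Finset ℕ} {R : ℕ} {Z E : ℝ} {X : ℕ}
    (h : SieveRange P R Z E X) (M : ℕ) :
    ∑ e ∈ Icc 1 M, thin P e ≤ 2 * M * Real.exp (-(1 / 4 * recipSum P)) + 8 * Z ^ R := by
  rw [sum_Icc_one]
  unfold thin
  have h1 : ∑ p ∈ P, (1 / 4) / (p : ℝ) * (1 - dvdOne p 1) = 1 / 4 * recipSum P := by
    rw [recipSum, Finset.mul_sum]
    apply Finset.sum_congr rfl
    intro p hp
    rw [dvdOne_eq_zero (h.prime p hp).not_dvd_one]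
    ring
  have h2 := sum_prod_one_sub_le h.prime h.one_le h.card_le h.even
    (x := fun p e => 1 / 4 * dvdOne p (e + 1))
    (fun p hp e => ⟨by linarith [dvdOne_nonneg p (e + 1)], by linarith [dvdOne_le_one p (e + 1)]⟩)
    (fun p _ e => by
      have := dvdOne_succ_periodic p e
      simp only at this
      simp only [this]) (fun p => (1 / 4) / p * (1 - dvdOne p 1))
    (fun p hp => by
      rw [(kappa_div_le (h.prime p hp) (by norm_num) 1).2, ← Finset.mul_sum,
        sum_dvdOne_succ (h.prime p hp), dvdOne_eq_zero (h.prime p hp).not_dvd_one]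
      ring)
    (fun p hp => (kappa_div_le (h.prime p hp) (by norm_num) 1).1)
    (fun p hp => by
      rw [(kappa_div_le (h.prime p hp) (by norm_num) 1).2]
      linarith [dvdOne_nonneg p 1])
    (level_le h.le_level (by norm_num) (by norm_num) 1) M
  rwa [h1] at h2

/-! ### The contribution of integers with few and with many prime factors -/

lemma sum_Icc_dvd {d : ℕ} (hd : 0 < d) (N : ℕ) (F : ℕ → ℝ) :
    ∑ n ∈ Icc 1 N, (if d ∣ n then F n else 0) = ∑ e ∈ Icc 1 (N / d), F (d * e) := by
  rw [← Finset.sum_filter]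
  symm
  apply Finset.sum_nbij (fun e => d * e)
  · intro e he
    rw [mem_Icc, Nat.le_div_iff_mul_le hd] at he
    rw [mem_filter, mem_Icc, mul_comm d e]
    exact ⟨⟨Nat.mul_pos he.1 hd, he.2⟩, dvd_mul_left d e⟩
  · intro a _ b _ hab
    exact Nat.eq_of_mul_eq_mul_left hd hab
  · intro n hn
    rw [mem_coe, mem_filter, mem_Icc] at hn
    obtain ⟨⟨h1, h2⟩, e, rfl⟩ := hn
    refine ⟨e, ?_, rfl⟩
    rw [mem_coe, mem_Icc, Nat.le_div_iff_mul_le hd, mul_comm e d]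
    exact ⟨Nat.pos_of_mul_pos_left h1, h2⟩
  · intro e _
    rfl

lemma sum_inv_Ioc_le {m n : ℕ} (hm : 1 ≤ m) (hmn : m ≤ n) :
    ∑ k ∈ Ioc m n, (1 : ℝ) / k ≤ Real.log (n / m) := by
  have hm0 : (0 : ℝ) < m := by exact_mod_cast hm
  induction n, hmn using Nat.le_induction with
  | base => simp [hm0.ne']
  | succ n hmn ih =>
    have hn0 : (0 : ℝ) < n := by exact_mod_cast (by omega : 0 < n)
    rw [Finset.sum_Ioc_succ_top (by omega)]
    have h1 : Real.log ((n + 1 : ℕ) / m) = Real.log (n / m) - Real.log (n / (n + 1 : ℕ)) := by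
      rw [← Real.log_div (by positivity) (by positivity)]
      congr 1
      push_cast
      field_simp
    have h2 := Real.log_le_sub_one_of_pos (show (0 : ℝ) < n / (n + 1 : ℕ) by positivity)
    have h3 : (n : ℝ) / (n + 1 : ℕ) - 1 = -(1 / (n + 1 : ℕ)) := by
      push_cast
      field_simp
      ring
    linarith

/-- A logarithmic mean is controlled by the ordinary means. -/
lemma sum_div_le_of_sum_le {f : ℕ → ℝ} {B : ℝ} (hB : 0 ≤ B) (hf0 : ∀ k, 0 ≤ f k) {m n : ℕ}
    (hm : 1 ≤ m) (hmn : m ≤ n) (hf : ∀ t, m ≤ t → ∑ k ∈ Icc 1 t, f k ≤ B * t) :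
    ∑ k ∈ Icc m n, f k / k ≤ B * (1 + Real.log (n / m)) := by
  have hm0 : (0 : ℝ) < m := by exact_mod_cast hm
  set c : ℕ → ℝ := fun k => if k = m then B * m else B with hc
  have hcsum : ∀ w : ℕ → ℝ, ∀ t, m ≤ t →
      ∑ k ∈ Icc m t, c k * w k = B * m * w m + B * ∑ k ∈ Ioc m t, w k := by
    intro w t ht
    rw [← Finset.Ioc_insert_left ht, Finset.sum_insert (by simp), Finset.mul_sum]
    congr 1
    · simp [hc]
    · apply Finset.sum_congr rfl
      intro k hk
      rw [mem_Ioc] at hk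
      simp only [hc]
      rw [if_neg (by omega)]
  have h1 : ∀ t, m ≤ t → 0 ≤ ∑ k ∈ Icc m t, (c k - f k) := by
    intro t ht
    have h2 := hcsum (fun _ => 1) t ht
    simp only [mul_one, Finset.sum_const, Nat.card_Ioc, nsmul_eq_mul] at h2
    rw [Finset.sum_sub_distrib, h2, Nat.cast_sub ht]
    have h3 : ∑ k ∈ Icc m t, f k ≤ ∑ k ∈ Icc 1 t, f k :=
      Finset.sum_le_sum_of_subset_of_nonneg (Finset.Icc_subset_Icc_left hm) fun k _ _ => hf0 k
    have h4 := hf t ht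
    linarith
  have h2 := sum_mul_antitone_nonneg (w := fun k => (1 : ℝ) / k) h1 (by
    intro k hk
    have : (0 : ℝ) < k := by exact_mod_cast (by omega : 0 < k)
    push_cast
    gcongr
    linarith) n hmn
  have h3 : 0 ≤ (∑ k ∈ Icc m n, (c k - f k)) * ((1 : ℝ) / n) :=
    mul_nonneg (h1 n hmn) (by positivity)
  have h4 := h3.trans h2
  simp only [sub_mul, Finset.sum_sub_distrib] at h4
  rw [hcsum (fun k => (1 : ℝ) / k) n hmn] at h4
  have h5 : B * m * (1 / (m : ℝ)) = B := by field_simp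
  have h6 := mul_le_mul_of_nonneg_left (sum_inv_Ioc_le hm hmn) hB
  simp only [mul_one_div] at h4 h6 h5
  linarith

lemma SieveRange.sum_thin_div_le {P : Finset ℕ} {R : ℕ} {Z E : ℝ} {X : ℕ}
    (h : SieveRange P R Z E X) {u v : ℕ} (hu : 1 ≤ u) (huv : u ≤ v) :
    ∑ d ∈ Ioo u v, thin P d / d
      ≤ (2 * Real.exp (-(1 / 4 * recipSum P)) + 8 * Z ^ R / u) * (1 + Real.log (v / u)) := by
  have hZ : 0 ≤ Z := zero_le_one.trans h.one_le
  have hu0 : (0 : ℝ) < u := by exact_mod_cast hu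
  refine le_trans ?_ (sum_div_le_of_sum_le (f := thin P) (by positivity) (thin_nonneg P) hu huv ?_)
  · apply Finset.sum_le_sum_of_subset_of_nonneg Finset.Ioo_subset_Icc_self
    intro k _ _
    exact div_nonneg (thin_nonneg P k) (by positivity)
  · intro t ht
    have ht' : (u : ℝ) ≤ t := by exact_mod_cast ht
    refine (h.sum_thin_le t).trans ?_
    have h1 : 8 * Z ^ R ≤ 8 * Z ^ R / u * t := by
      rw [div_mul_eq_mul_div, le_div_iff₀ hu0]
      gcongr
    linarith

/-- The number of divisors in `(u, v)`, averaged over sifted integers with few prime factors. -/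
lemma SieveRange.sum_sifted_thin_card_le {P : Finset ℕ} {R : ℕ} {Z E : ℝ} {X N : ℕ}
    (h : SieveRange P R Z E X) {u v : ℕ} (hu : 1 ≤ u) (huv : u ≤ v) (hv : v ≤ X) :
    ∑ n ∈ Icc 1 N, sifted P n * thin P n * #{d ∈ Ioo u v | d ∣ n}
      ≤ 2 * N * (Real.exp (-(5 / 4 * recipSum P)) * E) *
        ((2 * Real.exp (-(1 / 4 * recipSum P)) + 8 * Z ^ R / u) * (1 + Real.log (v / u)))
        + 8 * Z ^ R * v := by
  have hZ : 0 ≤ Z := zero_le_one.trans h.one_le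
  have hE : 0 ≤ E := zero_le_one.trans h.one_le_loss
  have hpos : ∀ d ∈ Ioo u v, 1 ≤ d ∧ d ≤ X := by
    intro d hd
    rw [mem_Ioo] at hd
    omega
  calc ∑ n ∈ Icc 1 N, sifted P n * thin P n * #{d ∈ Ioo u v | d ∣ n}
      = ∑ d ∈ Ioo u v, ∑ n ∈ Icc 1 N, (if d ∣ n then sifted P n * thin P n else 0) := by
        rw [Finset.sum_comm]
        apply Finset.sum_congr rfl
        intro n _
        rw [← Finset.sum_filter, Finset.sum_const, nsmul_eq_mul, mul_comm]
    _ = ∑ d ∈ Ioo u v, ∑ e ∈ Icc 1 (N / d), sifted P (d * e) * thin P (d * e) :=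
        Finset.sum_congr rfl fun d hd =>
          sum_Icc_dvd (hpos d hd).1 N fun n => sifted P n * thin P n
    _ ≤ ∑ d ∈ Ioo u v, (2 * N * (Real.exp (-(5 / 4 * recipSum P)) * E) * (thin P d / d)
          + 8 * Z ^ R) := by
        apply Finset.sum_le_sum
        intro d hd
        refine (h.sum_sifted_thin_le (hpos d hd).1 (hpos d hd).2 (N / d)).trans ?_
        have h1 : ((N / d : ℕ) : ℝ) ≤ N / d := Nat.cast_div_le
        have h2 := thin_nonneg P d
        have h3 : thin P d ≤ 1 := Finset.prod_le_one
          (fun p _ => by linarith [dvdOne_le_one p d]) fun p _ => by linarith [dvdOne_nonneg p d]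
        rw [mul_add]
        apply add_le_add
        · calc _ ≤ thin P d * (2 * (N / d) * (Real.exp (-(5 / 4 * recipSum P)) * E)) := by gcongr
            _ = _ := by ring
        · exact mul_le_of_le_one_left (by positivity) h3
    _ ≤ _ := by
        rw [Finset.sum_add_distrib, ← Finset.mul_sum, Finset.sum_const, nsmul_eq_mul]
        apply add_le_add
        · exact mul_le_mul_of_nonneg_left (h.sum_thin_div_le hu huv) (by positivity)
        · rw [mul_comm]
          apply mul_le_mul_of_nonneg_left _ (by positivity)
          rw [Nat.card_Ioo]
          exact_mod_cast (by omega : v - u - 1 ≤ v)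

/-- The number of primes from `P` dividing `n`. -/
def omegaIn (P : Finset ℕ) (n : ℕ) : ℕ := #{p ∈ P | p ∣ n}

lemma thin_eq (P : Finset ℕ) (n : ℕ) : thin P n = (3 / 4) ^ omegaIn P n := by
  unfold thin omegaIn
  rw [← Finset.prod_const, Finset.prod_filter]
  apply Finset.prod_congr rfl
  intro p _
  unfold dvdOne
  split_ifs <;> norm_num

lemma prod_primes_dvd_iff {m : Finset ℕ} (hm : ∀ p ∈ m, p.Prime) (n : ℕ) :
    ∏ p ∈ m, p ∣ n ↔ ∀ p ∈ m, p ∣ n := by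
  constructor
  · intro h p hp
    exact (Finset.dvd_prod_of_mem (fun p => p) hp).trans h
  · intro h
    exact Finset.prod_primes_dvd n (fun p hp => (hm p hp).prime) h

lemma pow_le_sum_smallSubsets {P : Finset ℕ} (hP : ∀ p ∈ P, p.Prime) {K n : ℕ}
    (hK : K ≤ omegaIn P n) :
    (3 / 2 : ℝ) ^ K ≤ ∑ m ∈ smallSubsets P K, (1 / 2) ^ #m * dvdOne (∏ p ∈ m, p) n := by
  obtain ⟨T, hT, hTK⟩ := Finset.exists_subset_card_eq hK
  have h1 : ∑ m ∈ T.powerset, (1 / 2 : ℝ) ^ #m = (3 / 2) ^ K := by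
    have := sum_powerset_prod T (fun _ => (1 / 2 : ℝ))
    simp only [Finset.prod_const, hTK] at this
    rw [this]
    norm_num
  rw [← h1]
  have h2 : T.powerset ⊆ smallSubsets P K := by
    intro m hm
    rw [mem_powerset] at hm
    rw [mem_smallSubsets]
    exact ⟨hm.trans (hT.trans (Finset.filter_subset _ _)), hTK ▸ Finset.card_le_card hm⟩
  refine le_trans (le_of_eq ?_) (Finset.sum_le_sum_of_subset_of_nonneg h2 fun m _ _ =>
    mul_nonneg (by positivity) (dvdOne_nonneg _ _))
  apply Finset.sum_congr rfl
  intro m hm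
  rw [dvdOne_eq_one, mul_one]
  rw [prod_primes_dvd_iff fun p hp => hP p ((mem_smallSubsets.1 (h2 hm)).1 hp)]
  intro p hp
  exact (mem_filter.1 (hT (mem_powerset.1 hm hp))).2

/-- The number of sifted integers with many prime factors. -/
lemma SieveRange.sum_sifted_omegaIn_le {P : Finset ℕ} {R : ℕ} {Z E : ℝ} {X N : ℕ}
    (h : SieveRange P R Z E X) (hN : N ≤ X) (K : ℕ) :
    (3 / 2) ^ K * ∑ n ∈ Icc 1 N, (if K ≤ omegaIn P n then sifted P n else 0)
      ≤ 2 * N * (Real.exp (-(1 / 2 * recipSum P)) * E) + 24 * Z ^ (R + K) := by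
  have hZ : 0 ≤ Z := zero_le_one.trans h.one_le
  have hE : 0 ≤ E := zero_le_one.trans h.one_le_loss
  have hprod : ∀ m ∈ smallSubsets P K, 1 ≤ ∏ p ∈ m, p := fun m hm =>
    Finset.prod_pos fun p hp => (h.prime p ((mem_smallSubsets.1 hm).1 hp)).pos
  calc (3 / 2) ^ K * ∑ n ∈ Icc 1 N, (if K ≤ omegaIn P n then sifted P n else 0)
      ≤ ∑ n ∈ Icc 1 N, ∑ m ∈ smallSubsets P K,
          (1 / 2) ^ #m * (if ∏ p ∈ m, p ∣ n then brun P R n else 0) := by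
        rw [Finset.mul_sum]
        apply Finset.sum_le_sum
        intro n _
        have hb := sifted_le_brun P h.even n
        have h0 := sifted_nonneg P n
        have h1 : ∀ m ∈ smallSubsets P K,
            (1 / 2 : ℝ) ^ #m * (if ∏ p ∈ m, p ∣ n then brun P R n else 0)
            = (1 / 2) ^ #m * dvdOne (∏ p ∈ m, p) n * brun P R n := by
          intro m _
          unfold dvdOne
          split_ifs <;> ring
        rw [Finset.sum_congr rfl h1, ← Finset.sum_mul]
        split_ifs with hK
        · exact mul_le_mul (pow_le_sum_smallSubsets h.prime hK) hb h0
            (Finset.sum_nonneg fun m _ => mul_nonneg (by positivity) (dvdOne_nonneg _ _))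
        · rw [mul_zero]
          exact mul_nonneg (Finset.sum_nonneg fun m _ =>
            mul_nonneg (by positivity) (dvdOne_nonneg _ _)) (h0.trans hb)
    _ = ∑ m ∈ smallSubsets P K, (1 / 2) ^ #m *
          ∑ e ∈ Icc 1 (N / ∏ p ∈ m, p), brun P R ((∏ p ∈ m, p) * e) := by
        rw [Finset.sum_comm]
        apply Finset.sum_congr rfl
        intro m hm
        rw [← Finset.mul_sum, sum_Icc_dvd (hprod m hm)]
    _ ≤ ∑ m ∈ smallSubsets P K, (2 * N * (Real.exp (-recipSum P) * E) *
          ∏ p ∈ m, ((1 / 2) * (1 / (p : ℝ))) + 8 * Z ^ R * (1 / 2) ^ #m) := by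
        apply Finset.sum_le_sum
        intro m hm
        set c := ∏ p ∈ m, p with hc
        have hc1 : (0 : ℝ) < c := by exact_mod_cast hprod m hm
        have h2 : ∏ p ∈ m, ((1 / 2) * (1 / (p : ℝ))) = (1 / 2) ^ #m * (1 / c) := by
          rw [Finset.prod_mul_distrib, Finset.prod_const, hc]
          push_cast
          rw [Finset.prod_div_distrib, Finset.prod_const_one]
        rw [h2]
        have h3 : ∑ e ∈ Icc 1 (N / c), brun P R (c * e)
            ≤ 2 * (N / c) * (Real.exp (-recipSum P) * E) + 8 * Z ^ R := by
          by_cases hcN : c ≤ N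
          · refine (h.sum_brun_le (hprod m hm) (hcN.trans hN) (N / c)).trans ?_
            have h1 : ((N / c : ℕ) : ℝ) ≤ N / c := Nat.cast_div_le
            gcongr
          · rw [Nat.div_eq_of_lt (by omega)]
            simp only [zero_lt_one, Finset.Icc_eq_empty_of_lt, Finset.sum_empty]
            positivity
        calc _ ≤ (1 / 2) ^ #m * (2 * (N / c) * (Real.exp (-recipSum P) * E) + 8 * Z ^ R) := by
              gcongr
          _ = _ := by ring
    _ ≤ 2 * N * (Real.exp (-recipSum P) * E) * Real.exp (1 / 2 * recipSum P)
          + 8 * Z ^ R * (3 * Z ^ K) := by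
        rw [Finset.sum_add_distrib, ← Finset.mul_sum, ← Finset.mul_sum]
        apply add_le_add
        · apply mul_le_mul_of_nonneg_left _ (by positivity)
          refine (sum_smallSubsets_prod_le P K _ fun p _ => by positivity).trans ?_
          rw [← Finset.mul_sum, recipSum]
        · apply mul_le_mul_of_nonneg_left _ (by positivity)
          refine (sum_smallSubsets_pow_le P K h.one_le h.card_le (by norm_num)).trans ?_
          apply mul_le_mul_of_nonneg_right _ (by positivity)
          have h1 : Real.exp (1 / 2) ≤ Real.exp 1 := Real.exp_le_exp.2 (by norm_num)
          linarith [Real.exp_one_lt_d9]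
    _ = _ := by
        have : Real.exp (-(1 / 2 * recipSum P))
            = Real.exp (-recipSum P) * Real.exp (1 / 2 * recipSum P) := by
          rw [← Real.exp_add]
          congr 1
          ring
        rw [this, pow_add]
        ring

/-! ### The weighted second moment -/

/-- The character sum over the divisors of `n` in `(u, v)`. -/
def charSum (u v n : ℕ) : ℝ := ∑ d ∈ Ioo u v, chi4 d * dvdOne d n

/-- The sieve weights summed over the multiples of `k` up to `N`. -/
def brunSum (P : Finset ℕ) (R N k : ℕ) : ℝ := ∑ h ∈ Icc 1 (N / k), brun P R (k * h)

/-- The contribution of the pair of divisors `g * a`, `g * b` to the second moment. -/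
def pairTerm (P : Finset ℕ) (R N u v g b a : ℕ) : ℝ :=
  if g * a ∈ Ioo u v ∧ g * b ∈ Ioo u v ∧ a.Coprime b then
    chi4 (g * a) * chi4 (g * b) * brunSum P R N (g * b * a) else 0

lemma sum_pair_eq (u v : ℕ) (F : ℕ → ℕ → ℝ) :
    ∑ d ∈ Ioo u v, ∑ d' ∈ Ioo u v, F d d' = ∑ g ∈ Icc 1 v, ∑ b ∈ Icc 1 v, ∑ a ∈ Icc 1 v,
      if g * a ∈ Ioo u v ∧ g * b ∈ Ioo u v ∧ a.Coprime b then F (g * a) (g * b) else 0 := by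
  simp only [← Finset.sum_product']
  rw [← Finset.sum_filter]
  symm
  apply Finset.sum_nbij (fun x => (x.1 * x.2.2, x.1 * x.2.1))
  · rintro ⟨g, b, a⟩ hx
    simp only [mem_filter] at hx
    exact mem_product.2 ⟨hx.2.1, hx.2.2.1⟩
  · rintro ⟨g, b, a⟩ hx ⟨g', b', a'⟩ hx' heq
    simp only [mem_coe, mem_filter, mem_product, mem_Icc] at hx hx'
    simp only [Prod.mk.injEq] at heq
    have h1 : (g * a).gcd (g * b) = g := by rw [Nat.gcd_mul_left, hx.2.2.2, mul_one]
    have h2 : (g' * a').gcd (g' * b') = g' := by rw [Nat.gcd_mul_left, hx'.2.2.2, mul_one]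
    have h3 : g = g' := by rw [← h1, ← h2, heq.1, heq.2]
    subst h3
    have hg : 0 < g := hx.1.1.1
    rw [Nat.eq_of_mul_eq_mul_left hg heq.1, Nat.eq_of_mul_eq_mul_left hg heq.2]
  · rintro ⟨d, d'⟩ hd
    simp only [coe_product, Set.mem_prod, mem_coe] at hd
    have hd1 := mem_Ioo.1 hd.1
    have hd2 := mem_Ioo.1 hd.2
    have hg : 0 < d.gcd d' := Nat.gcd_pos_of_pos_left _ (by omega)
    have e1 := Nat.mul_div_cancel' (Nat.gcd_dvd_left d d')
    have e2 := Nat.mul_div_cancel' (Nat.gcd_dvd_right d d')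
    refine ⟨(d.gcd d', d' / d.gcd d', d / d.gcd d'), ?_, ?_⟩
    · simp only [mem_coe, mem_filter, mem_product, mem_Icc, e1, e2]
      have a1 := Nat.gcd_le_left d' (by omega : 0 < d)
      have a2 := Nat.div_pos a1 hg
      have a3 := Nat.div_pos (Nat.gcd_le_right d (by omega : 0 < d')) hg
      have a4 := Nat.div_le_self d (d.gcd d')
      have a5 := Nat.div_le_self d' (d.gcd d')
      exact ⟨⟨⟨hg, by omega⟩, ⟨by omega, by omega⟩, by omega, by omega⟩, hd.1, hd.2,
        Nat.coprime_div_gcd_div_gcd hg⟩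
    · simp only [e1, e2]
  · rintro ⟨g, b, a⟩ _
    rfl

lemma sum_brun_charSum_sq (P : Finset ℕ) (R N u v : ℕ) :
    ∑ n ∈ Icc 1 N, brun P R n * charSum u v n ^ 2
      = ∑ g ∈ Icc 1 v, ∑ b ∈ Icc 1 v, ∑ a ∈ Icc 1 v, pairTerm P R N u v g b a := by
  have h1 : ∑ n ∈ Icc 1 N, brun P R n * charSum u v n ^ 2
      = ∑ d ∈ Ioo u v, ∑ d' ∈ Ioo u v, chi4 d * chi4 d' *
        ∑ n ∈ Icc 1 N, dvdOne d n * dvdOne d' n * brun P R n := by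
    have : ∀ n ∈ Icc 1 N, brun P R n * charSum u v n ^ 2 = ∑ d ∈ Ioo u v, ∑ d' ∈ Ioo u v,
        chi4 d * chi4 d' * (dvdOne d n * dvdOne d' n * brun P R n) := by
      intro n _
      rw [charSum, pow_two, Finset.sum_mul_sum, Finset.mul_sum]
      apply Finset.sum_congr rfl
      intro d _
      rw [Finset.mul_sum]
      apply Finset.sum_congr rfl
      intro d' _
      ring
    rw [Finset.sum_congr rfl this, Finset.sum_comm]
    apply Finset.sum_congr rfl
    intro d _
    rw [Finset.sum_comm]
    apply Finset.sum_congr rfl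
    intro d' _
    rw [Finset.mul_sum]
  rw [h1, sum_pair_eq]
  apply Finset.sum_congr rfl
  intro g hg
  apply Finset.sum_congr rfl
  intro b hb
  apply Finset.sum_congr rfl
  intro a ha
  unfold pairTerm
  split_ifs with hc
  · congr 1
    rw [mem_Icc] at hg hb ha
    have hpos : 0 < g * b * a := Nat.mul_pos (Nat.mul_pos hg.1 hb.1) ha.1
    rw [brunSum, ← sum_Icc_dvd hpos]
    apply Finset.sum_congr rfl
    intro n _
    have : g * b * a ∣ n ↔ g * a ∣ n ∧ g * b ∣ n := by
      have e : g * b * a = (g * a).lcm (g * b) := by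
        rw [Nat.lcm_mul_left, hc.2.2.lcm_eq_mul]
        ring
      rw [e, Nat.lcm_dvd_iff]
    unfold dvdOne
    by_cases h2 : g * a ∣ n <;> by_cases h3 : g * b ∣ n <;> simp [this, h2, h3]
  · rfl

lemma brun_eq (P : Finset ℕ) (hP : ∀ p ∈ P, p.Prime) (R n : ℕ) :
    brun P R n = ∑ m ∈ smallSubsets P R, (-1) ^ #m * dvdOne (∏ p ∈ m, p) (n + 1) := by
  unfold brun truncProd
  apply Finset.sum_congr rfl
  intro m hm
  have hm' : ∀ p ∈ m, p.Prime := fun p hp => hP p ((mem_smallSubsets.1 hm).1 hp)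
  rw [Finset.prod_neg]
  congr 1
  unfold dvdOne
  rw [Finset.prod_ite_zero, Finset.prod_const_one]
  exact if_congr (prod_primes_dvd_iff hm' _).symm rfl rfl

lemma card_smallSubsets_le {P : Finset ℕ} {R : ℕ} {Z E : ℝ} {X : ℕ} (h : SieveRange P R Z E X) :
    (#(smallSubsets P R) : ℝ) ≤ 3 * Z ^ R := by
  have h1 := sum_smallSubsets_pow_le P R h.one_le h.card_le zero_le_one
  simp only [one_pow, Finset.sum_const, nsmul_eq_mul, mul_one] at h1
  refine h1.trans ?_
  have : 0 ≤ Z := zero_le_one.trans h.one_le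
  gcongr
  linarith [Real.exp_one_lt_d9]

lemma sum_inv_Icc_le (n : ℕ) : ∑ k ∈ Icc 1 n, (1 : ℝ) / k ≤ 1 + Real.log n := by
  rcases Nat.eq_zero_or_pos n with rfl | hn
  · simp
  · have := sum_div_le_of_sum_le (f := fun _ => 1) zero_le_one (fun _ => zero_le_one) le_rfl hn
      (by simp)
    simpa using this

lemma one_add_log_nonneg (n : ℕ) : 0 ≤ 1 + Real.log n := by
  have := Real.log_natCast_nonneg n
  linarith

lemma sum_card_divisors_div_le (n : ℕ) :
    ∑ b ∈ Icc 1 n, (#b.divisors : ℝ) / b ≤ (1 + Real.log n) ^ 2 := by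
  have h1 : ∀ b ∈ Icc 1 n, (#b.divisors : ℝ) / b
      = ∑ c ∈ Icc 1 n, (if c ∣ b then 1 / (b : ℝ) else 0) := by
    intro b hb
    rw [mem_Icc] at hb
    rw [← Finset.sum_filter, Finset.sum_const, nsmul_eq_mul, mul_one_div]
    congr 3
    ext c
    rw [Nat.mem_divisors, mem_filter, mem_Icc]
    constructor
    · rintro ⟨h2, _⟩
      exact ⟨⟨Nat.pos_of_dvd_of_pos h2 hb.1, (Nat.le_of_dvd hb.1 h2).trans hb.2⟩, h2⟩
    · rintro ⟨_, h2⟩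
      exact ⟨h2, by omega⟩
  rw [Finset.sum_congr rfl h1, Finset.sum_comm]
  calc ∑ c ∈ Icc 1 n, ∑ b ∈ Icc 1 n, (if c ∣ b then 1 / (b : ℝ) else 0)
      ≤ ∑ c ∈ Icc 1 n, 1 / (c : ℝ) * (1 + Real.log n) := by
        apply Finset.sum_le_sum
        intro c hc
        rw [mem_Icc] at hc
        rw [sum_Icc_dvd hc.1 n fun b => 1 / (b : ℝ)]
        refine le_trans ?_ (mul_le_mul_of_nonneg_left (sum_inv_Icc_le n) (by positivity))
        rw [Finset.mul_sum]
        refine le_trans (le_of_eq ?_) (Finset.sum_le_sum_of_subset_of_nonneg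
          (Finset.Icc_subset_Icc_right (Nat.div_le_self n c)) fun _ _ _ => by positivity)
        apply Finset.sum_congr rfl
        intro e _
        push_cast
        rw [one_div_mul_one_div]
    _ ≤ _ := by
        rw [← Finset.sum_mul, pow_two]
        exact mul_le_mul_of_nonneg_right (sum_inv_Icc_le n) (one_add_log_nonneg n)

/-- The part of the second moment with `a` in a given set. -/
def partSum (P : Finset ℕ) (R N u v : ℕ) (q : ℕ → Prop) [DecidablePred q] : ℝ :=
  ∑ g ∈ Icc 1 v, ∑ b ∈ Icc 1 v, ∑ a ∈ (Icc 1 v).filter q, pairTerm P R N u v g b a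

lemma sum_pairTerm_eq (P : Finset ℕ) (R N u v g b : ℕ) (q : ℕ → Prop) [DecidablePred q] :
    ∑ a ∈ (Icc 1 v).filter q, pairTerm P R N u v g b a
      = (if g * b ∈ Ioo u v then chi4 g ^ 2 * chi4 b else 0) *
        ∑ a ∈ (Icc 1 v).filter (fun a => q a ∧ g * a ∈ Ioo u v),
          chi4 a * (if a.Coprime b then 1 else 0) * brunSum P R N (g * b * a) := by
  rw [← Finset.filter_filter, Finset.sum_filter (fun a => g * a ∈ Ioo u v), Finset.mul_sum]
  apply Finset.sum_congr rfl
  intro a _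
  unfold pairTerm
  rw [chi4_mul, chi4_mul]
  by_cases h1 : g * a ∈ Ioo u v <;> by_cases h2 : g * b ∈ Ioo u v <;> by_cases h3 : a.Coprime b <;>
    simp only [h1, h2, h3, and_self, true_and, and_false, false_and, if_true, if_false,
      zero_mul, mul_zero]
  rw [if_pos h3, if_pos h3]
  ring

lemma abs_coeff_le_one (u v g b : ℕ) :
    |if g * b ∈ Ioo u v then chi4 g ^ 2 * chi4 b else 0| ≤ 1 := by
  split_ifs
  · rw [abs_mul, abs_pow]
    exact mul_le_one₀ (pow_le_one₀ (abs_nonneg _) (abs_chi4_le_one g)) (abs_nonneg _)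
      (abs_chi4_le_one b)
  · simp

lemma brunSum_eq {P : Finset ℕ} (hP : ∀ p ∈ P, p.Prime) (R N k : ℕ) :
    brunSum P R N k = ∑ m ∈ smallSubsets P R, (-1) ^ #m *
      ∑ h ∈ Icc 1 (N / k), dvdOne (∏ p ∈ m, p) (k * h + 1) := by
  unfold brunSum
  simp_rw [brun_eq P hP]
  rw [Finset.sum_comm]
  simp_rw [Finset.mul_sum]

lemma odd_prod {m : Finset ℕ} (hm : ∀ p ∈ m, Odd p) : Odd (∏ p ∈ m, p) :=
  Finset.prod_induction _ Odd (fun _ _ ha hb => ha.mul hb) odd_one hm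

lemma abs_sum_signed_le {ι : Type*} (s : Finset ι) (ε f : ι → ℝ) (B : ℝ) (hε : ∀ i ∈ s, |ε i| ≤ 1)
    (hf : ∀ i ∈ s, |f i| ≤ B) : |∑ i ∈ s, ε i * f i| ≤ #s * B := by
  rw [← nsmul_eq_mul]
  refine (Finset.abs_sum_le_sum_abs _ _).trans (Finset.sum_le_card_nsmul _ _ _ fun i hi => ?_)
  rw [abs_mul]
  exact (mul_le_of_le_one_left (abs_nonneg _) (hε i hi)).trans (hf i hi)

lemma abs_neg_one_pow_le (k : ℕ) : |(-1 : ℝ) ^ k| ≤ 1 := by simp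

lemma sum_ite_mul_le {k N : ℕ} (hk : 0 < k) {B : ℝ} (hB : 0 ≤ B) :
    ∑ h ∈ Icc 1 N, (if k * h ≤ N then B else 0) ≤ B * (N / k) := by
  rw [← Finset.sum_filter, Finset.sum_const, nsmul_eq_mul, mul_comm]
  apply mul_le_mul_of_nonneg_left _ hB
  have h1 : #{h ∈ Icc 1 N | k * h ≤ N} ≤ N / k := by
    calc _ ≤ #(Icc 1 (N / k)) := by
          apply Finset.card_le_card
          intro h hh
          rw [mem_filter, mem_Icc] at hh
          rw [mem_Icc, Nat.le_div_iff_mul_le hk, mul_comm]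
          exact ⟨hh.1.1, hh.2⟩
      _ = N / k := by simp
  exact (Nat.cast_le.2 h1).trans Nat.cast_div_le

lemma abs_sum_tail_le {P : Finset ℕ} {R : ℕ} {Z E : ℝ} {X : ℕ} (h : SieveRange P R Z E X)
    {N u v A g b : ℕ} (hA : 0 < A) (hg : 0 < g) (hb : 0 < b) :
    |∑ a ∈ (Icc 1 v).filter (fun a => A < a ∧ g * a ∈ Ioo u v),
      chi4 a * (if a.Coprime b then 1 else 0) * brunSum P R N (g * b * a)|
      ≤ 24 * Z ^ R * (N / A) * (1 / g * (#b.divisors / b)) := by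
  have hZ : 0 ≤ Z := zero_le_one.trans h.one_le
  set s := (Icc 1 v).filter (fun a => A < a ∧ g * a ∈ Ioo u v) with hs
  have h1 : ∑ a ∈ s, chi4 a * (if a.Coprime b then 1 else 0) * brunSum P R N (g * b * a)
      = ∑ m ∈ smallSubsets P R, (-1) ^ #m * ∑ t ∈ Icc 1 N,
        ∑ a ∈ s.filter (fun a => g * b * a * t ≤ N),
          chi4 a * (if a.Coprime b then 1 else 0) * dvdInd (∏ p ∈ m, p) (g * b * t) 1 a := by
    simp_rw [brunSum_eq h.prime, Finset.mul_sum]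
    rw [Finset.sum_comm]
    apply Finset.sum_congr rfl
    intro m _
    simp_rw [Finset.sum_filter]
    have : ∀ a ∈ s, ∑ t ∈ Icc 1 (N / (g * b * a)), chi4 a * (if a.Coprime b then 1 else 0) *
        ((-1) ^ #m * dvdOne (∏ p ∈ m, p) (g * b * a * t + 1))
        = ∑ t ∈ Icc 1 N, (-1) ^ #m * if g * b * a * t ≤ N then
          chi4 a * (if a.Coprime b then 1 else 0) * dvdInd (∏ p ∈ m, p) (g * b * t) 1 a
          else 0 := by
      intro a ha
      rw [hs, mem_filter, mem_Icc] at ha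
      have hk : 0 < g * b * a := Nat.mul_pos (Nat.mul_pos hg hb) ha.1.1
      have : Icc 1 (N / (g * b * a)) = (Icc 1 N).filter (fun t => g * b * a * t ≤ N) := by
        ext t
        rw [mem_filter, mem_Icc, mem_Icc, Nat.le_div_iff_mul_le hk, mul_comm t]
        have := Nat.le_mul_of_pos_left t hk
        constructor
        · rintro ⟨h1, h2⟩
          exact ⟨⟨h1, this.trans h2⟩, h2⟩
        · rintro ⟨⟨h1, _⟩, h2⟩
          exact ⟨h1, h2⟩
      rw [this, Finset.sum_filter]
      apply Finset.sum_congr rfl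
      intro t _
      unfold dvdOne dvdInd
      rw [mul_right_comm (g * b) a t]
      by_cases h2 : g * b * t * a ≤ N
      · simp only [h2, if_true]
        ring
      · simp only [h2, if_false, mul_zero]
    rw [Finset.sum_congr rfl this, Finset.sum_comm]
    simp_rw [mul_ite, mul_zero]
  rw [h1]
  have hτ : (0 : ℝ) ≤ 2 * (4 * #b.divisors) := by positivity
  have hk : 0 < g * b * A := Nat.mul_pos (Nat.mul_pos hg hb) hA
  refine (abs_sum_signed_le _ _ _ (2 * (4 * #b.divisors) * (N / (g * b * A : ℕ)))
    (fun m _ => abs_neg_one_pow_le _) ?_).trans ?_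
  · intro m hm
    refine (Finset.abs_sum_le_sum_abs _ _).trans (le_trans ?_ (sum_ite_mul_le hk hτ))
    apply Finset.sum_le_sum
    intro t ht
    rw [mem_Icc] at ht
    split_ifs with hN
    · apply abs_sum_convex_le
      · exact abs_sum_chi4_coprime_le
          (odd_prod fun p hp => h.odd p ((mem_smallSubsets.1 hm).1 hp)) _ hb.ne'
      · intro x hx y hy z hxz hzy
        simp only [hs, mem_filter, mem_Icc, mem_Ioo] at hx hy ⊢
        have e1 := Nat.mul_le_mul_left g hxz
        have e2 := Nat.mul_le_mul_left g hzy
        have e3 := Nat.mul_le_mul_right t (Nat.mul_le_mul_left (g * b) hzy)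
        omega
    · have : s.filter (fun a => g * b * a * t ≤ N) = ∅ := by
        apply Finset.filter_false_of_mem
        intro a ha hle
        rw [hs, mem_filter] at ha
        apply hN
        exact (Nat.mul_le_mul_right t (Nat.mul_le_mul_left (g * b) ha.2.1.le)).trans hle
      rw [this]
      simp
  · have hg0 : (0 : ℝ) < g := by exact_mod_cast hg
    have hb0 : (0 : ℝ) < b := by exact_mod_cast hb
    have hA0 : (0 : ℝ) < A := by exact_mod_cast hA
    calc _ ≤ 3 * Z ^ R * (2 * (4 * #b.divisors) * (N / (g * b * A : ℕ))) := by
          apply mul_le_mul_of_nonneg_right (card_smallSubsets_le h) (by positivity)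
      _ = _ := by
          push_cast
          field_simp
          ring

lemma sum_inv_mul_card_divisors_le (n : ℕ) :
    ∑ g ∈ Icc 1 n, ∑ b ∈ Icc 1 n, 1 / (g : ℝ) * (#b.divisors / b) ≤ (1 + Real.log n) ^ 3 := by
  rw [← Finset.sum_mul_sum, pow_succ' _ 2]
  exact mul_le_mul (sum_inv_Icc_le n) (sum_card_divisors_div_le n)
    (Finset.sum_nonneg fun _ _ => by positivity) (one_add_log_nonneg n)

lemma abs_partSum_le (P : Finset ℕ) (R N u v : ℕ) (q : ℕ → Prop) [DecidablePred q]
    {B : ℕ → ℕ → ℝ} (hB : ∀ g ∈ Icc 1 v, ∀ b ∈ Icc 1 v,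
      g * b ∈ Ioo u v → |∑ a ∈ (Icc 1 v).filter (fun a => q a ∧ g * a ∈ Ioo u v),
        chi4 a * (if a.Coprime b then 1 else 0) * brunSum P R N (g * b * a)| ≤ B g b) :
    |partSum P R N u v q|
      ≤ ∑ g ∈ Icc 1 v, ∑ b ∈ Icc 1 v, if g * b ∈ Ioo u v then B g b else 0 := by
  unfold partSum
  refine (Finset.abs_sum_le_sum_abs _ _).trans (Finset.sum_le_sum fun g hg => ?_)
  refine (Finset.abs_sum_le_sum_abs _ _).trans (Finset.sum_le_sum fun b hb => ?_)
  rw [sum_pairTerm_eq]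
  split_ifs with hgb
  · rw [abs_mul]
    have := abs_coeff_le_one u v g b
    rw [if_pos hgb] at this
    exact (mul_le_of_le_one_left (abs_nonneg _) this).trans (hB g hg b hb hgb)
  · simp

lemma abs_partSum_tail_le {P : Finset ℕ} {R : ℕ} {Z E : ℝ} {X : ℕ} (h : SieveRange P R Z E X)
    (N u v : ℕ) {A : ℕ} (hA : 0 < A) :
    |partSum P R N u v (fun a => A < a)| ≤ 24 * Z ^ R * (N / A) * (1 + Real.log v) ^ 3 := by
  have hZ : 0 ≤ Z := zero_le_one.trans h.one_le
  refine (abs_partSum_le P R N u v _ fun g hg b hb _ =>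
    abs_sum_tail_le h hA (mem_Icc.1 hg).1 (mem_Icc.1 hb).1).trans ?_
  refine le_trans ?_ (mul_le_mul_of_nonneg_left (sum_inv_mul_card_divisors_le v) (by positivity))
  rw [Finset.mul_sum]
  apply Finset.sum_le_sum
  intro g _
  rw [Finset.mul_sum]
  apply Finset.sum_le_sum
  intro b _
  split_ifs
  · rfl
  · positivity

lemma abs_sum_dvdOne_sub_le {ν k N : ℕ} (hν : 0 < ν) (hk : 0 < k) :
    |∑ t ∈ Icc 1 (N / k), dvdOne ν (k * t + 1)
      - (if ν.Coprime k then (N : ℝ) / (k * ν) else 0)| ≤ 2 := by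
  have hν0 : (1 : ℝ) ≤ ν := by exact_mod_cast hν
  have hk0 : (0 : ℝ) < k := by exact_mod_cast hk
  have h1 : ∑ t ∈ Icc 1 (N / k), dvdOne ν (k * t + 1)
      = ∑ t ∈ range (N / k), dvdInd ν k (k + 1) t := by
    rw [sum_Icc_one]
    apply Finset.sum_congr rfl
    intro t _
    unfold dvdOne dvdInd
    rw [mul_add, mul_one, add_assoc]
  have h2 := abs_sum_range_sub_le hν (dvdInd_periodic ν k (k + 1)) (dvdInd_nonneg ν k (k + 1))
    (N / k)
  rw [h1]
  by_cases hc : ν.Coprime k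
  · rw [sum_dvdInd_of_coprime hν hc] at h2
    rw [if_pos hc]
    have h3 : ((N / k : ℕ) : ℝ) ≤ N / k := Nat.cast_div_le
    have h4 : (N : ℝ) / k - 1 ≤ (N / k : ℕ) := by
      rw [sub_le_iff_le_add, div_le_iff₀ hk0]
      have := Nat.lt_div_mul_add (a := N) hk
      have h5 : N ≤ (N / k + 1) * k := by
        rw [add_mul, one_mul]
        exact this.le
      exact_mod_cast h5
    have h5 : (N : ℝ) / (k * ν) = N / k * (1 / ν) := by field_simp
    have h6 : (1 : ℝ) / ν ≤ 1 := by rw [div_le_one (by linarith)]; exact hν0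
    have h7 : (0 : ℝ) ≤ 1 / ν := by positivity
    rw [h5]
    have h8 := abs_le.1 h2
    rw [abs_le]
    constructor <;> nlinarith
  · have h3 : ∑ t ∈ range ν, dvdInd ν k (k + 1) t = 0 := by
      apply Finset.sum_eq_zero
      intro t _
      unfold dvdInd
      rw [if_neg]
      intro hd
      apply hc
      have e : k * t + (k + 1) = k * (t + 1) + 1 := by ring
      rw [e] at hd
      have e1 : ν.gcd k ∣ k * (t + 1) := (Nat.gcd_dvd_right ν k).mul_right _
      exact Nat.dvd_one.1 ((Nat.dvd_add_right e1).1 ((Nat.gcd_dvd_left ν k).trans hd))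
    rw [h3] at h2
    rw [if_neg hc]
    simp only [zero_div, mul_zero] at h2
    linarith

lemma card_divisors_mul_le (m n : ℕ) : #(m * n).divisors ≤ #m.divisors * #n.divisors := by
  classical
  rw [Nat.divisors_mul]
  exact Finset.card_mul_le

lemma card_divisors_prod_le {m : Finset ℕ} (hm : ∀ p ∈ m, p.Prime) :
    #(∏ p ∈ m, p).divisors ≤ 2 ^ #m := by
  induction m using Finset.induction_on with
  | empty => simp
  | insert a m ha ih =>
    rw [Finset.prod_insert ha, Finset.card_insert_of_notMem ha, pow_succ']
    refine (card_divisors_mul_le _ _).trans (Nat.mul_le_mul ?_ ?_)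
    · rw [(hm a (mem_insert_self a m)).divisors]
      exact Finset.card_le_two
    · exact ih fun p hp => hm p (mem_insert_of_mem hp)

/-- A logarithmically weighted character sum over integers coprime to `q`. -/
lemma abs_sum_chi4_coprime_div_le {q A : ℕ} (hq : q ≠ 0) (hA : 0 < A) {s : Finset ℕ}
    (hconv : ∀ x ∈ s, ∀ y ∈ s, ∀ z, x ≤ z → z ≤ y → z ∈ s) (hs : ∀ x ∈ s, A < x) :
    |∑ a ∈ s, chi4 a * (if a.Coprime q then 1 else 0) * (1 / (a : ℝ))|
      ≤ 8 * #q.divisors / A := by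
  have hA0 : (0 : ℝ) < A := by exact_mod_cast hA
  have h1 := abs_sum_mul_antitone_le (s := s) (w := fun a => 1 / (a : ℝ)) (W := 1 / (A : ℝ))
    (fun M => abs_sum_chi4_coprime_le odd_one 0 hq M) hconv ?_ ?_ ?_ (by positivity)
  · have h2 : ∀ a, dvdInd 1 0 1 a = 1 := fun a => by simp [dvdInd]
    simp only [h2, mul_one] at h1
    refine h1.trans (le_of_eq ?_)
    ring
  · intro x hx n hn
    have : (0 : ℝ) < n := by exact_mod_cast (lt_of_lt_of_le (by omega) ((hs x hx).le.trans hn))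
    push_cast
    gcongr
    linarith
  · intro x _ n _
    positivity
  · intro x hx
    have : (A : ℝ) ≤ x := by exact_mod_cast (hs x hx).le
    gcongr

lemma abs_sum_mid_le {P : Finset ℕ} {R : ℕ} {Z E : ℝ} {X : ℕ} (h : SieveRange P R Z E X)
    {N u v A A' g b : ℕ} (hA : 0 < A) (hg : 0 < g) (hb : 0 < b) :
    |∑ a ∈ (Icc 1 v).filter (fun a => (A < a ∧ a ≤ A') ∧ g * a ∈ Ioo u v),
      chi4 a * (if a.Coprime b then 1 else 0) * brunSum P R N (g * b * a)|
      ≤ 6 * Z ^ R * A' +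
        8 * (N / A) * Real.exp (2 * recipSum P) * (1 / g * (#b.divisors / b)) := by
  have hZ : 0 ≤ Z := zero_le_one.trans h.one_le
  have hg0 : (0 : ℝ) < g := by exact_mod_cast hg
  have hb0 : (0 : ℝ) < b := by exact_mod_cast hb
  have hA0 : (0 : ℝ) < A := by exact_mod_cast hA
  set s := (Icc 1 v).filter (fun a => (A < a ∧ a ≤ A') ∧ g * a ∈ Ioo u v) with hs
  set c : ℕ → ℝ := fun a => chi4 a * (if a.Coprime b then 1 else 0) with hc
  have hc1 : ∀ a, |c a| ≤ 1 := by
    intro a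
    simp only [hc]
    rw [abs_mul]
    apply mul_le_one₀ (abs_chi4_le_one a) (abs_nonneg _)
    split_ifs <;> simp
  set M : Finset ℕ → ℕ → ℝ := fun m a =>
    if (∏ p ∈ m, p).Coprime (g * b * a) then (N : ℝ) / ((g * b * a : ℕ) * (∏ p ∈ m, p : ℕ))
      else 0 with hM
  have hν : ∀ m ∈ smallSubsets P R, (∀ p ∈ m, p.Prime) ∧ 0 < ∏ p ∈ m, p := by
    intro m hm
    have : ∀ p ∈ m, p.Prime := fun p hp => h.prime p ((mem_smallSubsets.1 hm).1 hp)
    exact ⟨this, Finset.prod_pos fun p hp => (this p hp).pos⟩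
  have hscard : (#s : ℝ) ≤ A' := by
    have : #s ≤ #(Icc 1 A') := by
      apply Finset.card_le_card
      intro a ha
      rw [hs, mem_filter, mem_Icc] at ha
      rw [mem_Icc]
      exact ⟨ha.1.1, ha.2.1.2⟩
    rw [Nat.card_Icc, Nat.add_sub_cancel] at this
    exact_mod_cast this
  have h1 : ∑ a ∈ s, c a * brunSum P R N (g * b * a)
      = ∑ m ∈ smallSubsets P R, (-1) ^ #m * (∑ a ∈ s, c a *
          (∑ t ∈ Icc 1 (N / (g * b * a)), dvdOne (∏ p ∈ m, p) (g * b * a * t + 1) - M m a))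
        + ∑ m ∈ smallSubsets P R, (-1) ^ #m * ∑ a ∈ s, c a * M m a := by
    rw [← Finset.sum_add_distrib]
    simp_rw [brunSum_eq h.prime, Finset.mul_sum (s := smallSubsets P R)]
    rw [Finset.sum_comm]
    apply Finset.sum_congr rfl
    intro m _
    rw [← mul_add, ← Finset.sum_add_distrib, Finset.mul_sum]
    apply Finset.sum_congr rfl
    intro a _
    ring
  have hmain : ∀ m ∈ smallSubsets P R, |(-1) ^ #m * ∑ a ∈ s, c a * M m a|
      ≤ 8 * (N / A) * (1 / g * (#b.divisors / b)) * ∏ p ∈ m, (2 * (1 / (p : ℝ))) := by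
    intro m hm
    obtain ⟨hmp, hpos⟩ := hν m hm
    have hν0 : (0 : ℝ) < (∏ p ∈ m, p : ℕ) := by exact_mod_cast hpos
    have h2 : ∏ p ∈ m, (2 * (1 / (p : ℝ))) = 2 ^ #m / (∏ p ∈ m, p : ℕ) := by
      rw [Finset.prod_mul_distrib, Finset.prod_const]
      push_cast
      rw [Finset.prod_div_distrib, Finset.prod_const_one, mul_one_div]
    rw [h2]
    set ν := ∏ p ∈ m, p with hνdef
    have h3 : ∀ a ∈ s, c a * M m a = (if ν.Coprime (g * b) then (N : ℝ) / (g * b * ν) else 0) *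
        (chi4 a * (if a.Coprime (b * ν) then 1 else 0) * (1 / (a : ℝ))) := by
      intro a ha
      rw [hs, mem_filter, mem_Icc] at ha
      have ha0 : (0 : ℝ) < a := by exact_mod_cast ha.1.1
      simp only [hc, hM, ← hνdef]
      have H : a.Coprime b ∧ ν.Coprime (g * b * a) ↔ ν.Coprime (g * b) ∧ a.Coprime (b * ν) := by
        rw [Nat.coprime_mul_iff_right (k := ν) (n := a), Nat.coprime_mul_iff_right (k := a),
          Nat.coprime_comm (n := a) (m := ν)]
        tauto
      by_cases e : ν.Coprime (g * b) ∧ a.Coprime (b * ν)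
      · rw [if_pos (H.2 e).1, if_pos (H.2 e).2, if_pos e.1, if_pos e.2]
        push_cast
        field_simp
      · have e' := mt H.1 e
        rw [not_and_or] at e
        rw [not_and_or] at e'
        trans 0
        · rcases e' with e' | e' <;> rw [if_neg e'] <;> ring
        · rcases e with e | e <;> rw [if_neg e] <;> ring
    rw [Finset.sum_congr rfl h3, ← Finset.mul_sum, abs_mul, abs_mul]
    have h4 := abs_sum_chi4_coprime_div_le (q := b * ν) (Nat.mul_pos hb hpos).ne' hA (s := s)
      (by
        intro x hx y hy z hxz hzy
        simp only [hs, mem_filter, mem_Icc, mem_Ioo] at hx hy ⊢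
        have e1 := Nat.mul_le_mul_left g hxz
        have e2 := Nat.mul_le_mul_left g hzy
        omega)
      (by
        intro x hx
        rw [hs, mem_filter] at hx
        exact hx.2.1.1)
    have h5 : (#(b * ν).divisors : ℝ) ≤ #b.divisors * 2 ^ #m := by
      have := (card_divisors_mul_le b ν).trans
        (Nat.mul_le_mul_left _ (card_divisors_prod_le hmp))
      exact_mod_cast this
    have h6 : |if ν.Coprime (g * b) then (N : ℝ) / (g * b * ν) else 0| ≤ N / (g * b * ν) := by
      split_ifs
      · rw [abs_of_nonneg (by positivity)]
      · rw [abs_zero]; positivity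
    calc |(-1 : ℝ) ^ #m| * (|if ν.Coprime (g * b) then (N : ℝ) / (g * b * ν) else 0| *
          |∑ a ∈ s, chi4 a * (if a.Coprime (b * ν) then 1 else 0) * (1 / (a : ℝ))|)
        ≤ 1 * (N / (g * b * ν) * (8 * (#b.divisors * 2 ^ #m) / A)) := by
          gcongr
          · exact abs_neg_one_pow_le _
          · exact h4.trans (by gcongr)
      _ = _ := by field_simp
  rw [h1]
  refine (abs_add_le _ _).trans (add_le_add ?_ ?_)
  · refine (abs_sum_signed_le _ _ _ (A' * 2) (fun m _ => abs_neg_one_pow_le _) ?_).trans ?_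
    · intro m hm
      refine (abs_sum_signed_le s c _ 2 (fun a _ => hc1 a) ?_).trans ?_
      · intro a ha
        rw [hs, mem_filter, mem_Icc] at ha
        exact abs_sum_dvdOne_sub_le (hν m hm).2 (Nat.mul_pos (Nat.mul_pos hg hb) ha.1.1)
      · gcongr
    · calc _ ≤ 3 * Z ^ R * ((A' : ℝ) * 2) := by
            gcongr
            exact card_smallSubsets_le h
        _ = _ := by ring
  · refine (Finset.abs_sum_le_sum_abs _ _).trans ((Finset.sum_le_sum hmain).trans ?_)
    rw [← Finset.mul_sum]
    have h7 := sum_smallSubsets_prod_le P R (fun p => 2 * (1 / (p : ℝ)))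
      (fun p _ => by positivity)
    rw [← Finset.mul_sum] at h7
    calc _ ≤ 8 * (N / A) * (1 / g * (#b.divisors / b)) * Real.exp (2 * recipSum P) := by
          gcongr
          exact h7
      _ = _ := by ring

lemma card_mul_lt_le (v : ℕ) :
    ∑ g ∈ Icc 1 v, ∑ b ∈ Icc 1 v, (if g * b < v then (1 : ℝ) else 0) ≤ v * (1 + Real.log v) := by
  calc _ ≤ ∑ g ∈ Icc 1 v, (v : ℝ) * (1 / g) := by
        apply Finset.sum_le_sum
        intro g hg
        rw [mem_Icc] at hg
        refine le_trans ?_ ((sum_ite_mul_le (N := v) hg.1 zero_le_one).trans (le_of_eq (by ring)))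
        apply Finset.sum_le_sum
        intro b _
        split_ifs <;> first | rfl | omega | norm_num
    _ ≤ _ := by
        rw [← Finset.mul_sum]
        exact mul_le_mul_of_nonneg_left (sum_inv_Icc_le v) (by positivity)

lemma abs_partSum_mid_le {P : Finset ℕ} {R : ℕ} {Z E : ℝ} {X : ℕ} (h : SieveRange P R Z E X)
    (N u v A' : ℕ) {A : ℕ} (hA : 0 < A) :
    |partSum P R N u v (fun a => A < a ∧ a ≤ A')| ≤ 6 * Z ^ R * A' * (v * (1 + Real.log v)) +
      8 * (N / A) * Real.exp (2 * recipSum P) * (1 + Real.log v) ^ 3 := by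
  have hZ : 0 ≤ Z := zero_le_one.trans h.one_le
  refine (abs_partSum_le P R N u v _ fun g hg b hb _ =>
    abs_sum_mid_le h hA (mem_Icc.1 hg).1 (mem_Icc.1 hb).1).trans ?_
  refine le_trans ?_ (add_le_add
    (mul_le_mul_of_nonneg_left (card_mul_lt_le v) (by positivity : 0 ≤ 6 * Z ^ R * (A' : ℝ)))
    (mul_le_mul_of_nonneg_left (sum_inv_mul_card_divisors_le v) (by positivity)))
  simp_rw [Finset.mul_sum]
  rw [← Finset.sum_add_distrib]
  apply Finset.sum_le_sum
  intro g _
  rw [← Finset.sum_add_distrib]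
  apply Finset.sum_le_sum
  intro b _
  by_cases hgb : g * b ∈ Ioo u v
  · rw [if_pos hgb, if_pos (mem_Ioo.1 hgb).2, mul_one]
  · rw [if_neg hgb]
    split_ifs <;> positivity

lemma sum_inv_dilate_le {u v a : ℕ} (hu : 1 ≤ u) (huv : u ≤ v) :
    ∑ g ∈ (Icc 1 v).filter (fun g => g * a ∈ Ioo u v), (1 : ℝ) / g ≤ 1 + Real.log (v / u) := by
  have hu0 : (0 : ℝ) < u := by exact_mod_cast hu
  set s := (Icc 1 v).filter (fun g => g * a ∈ Ioo u v) with hs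
  rcases s.eq_empty_or_nonempty with he | hne
  · rw [he, Finset.sum_empty]
    have : (1 : ℝ) ≤ v / u := by
      rw [one_le_div hu0]
      exact_mod_cast huv
    linarith [Real.log_nonneg this]
  · have h1 := s.min'_mem hne
    have h2 := s.max'_mem hne
    have h3 : s.min' hne ≤ s.max' hne := s.min'_le _ h2
    set m := s.min' hne with hm
    set n := s.max' hne with hn
    have h4 : s ⊆ Icc m n := fun g hg => mem_Icc.2 ⟨s.min'_le g hg, s.le_max' g hg⟩
    rw [hs, mem_filter, mem_Icc, mem_Ioo] at h1 h2
    refine (Finset.sum_le_sum_of_subset_of_nonneg h4 fun _ _ _ => by positivity).trans ?_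
    refine (sum_div_le_of_sum_le (f := fun _ => 1) zero_le_one (fun _ => zero_le_one) h1.1.1 h3
      (by simp)).trans ?_
    rw [one_mul]
    have hm0 : (0 : ℝ) < m := by exact_mod_cast h1.1.1
    have hn0 : (0 : ℝ) < n := by exact_mod_cast h2.1.1
    have ha : 0 < a := Nat.pos_of_ne_zero fun h0 => by simp [h0] at h1
    have h5 : n * u ≤ v * m := by
      apply Nat.le_of_mul_le_mul_right _ ha
      calc n * u * a = (n * a) * u := by ring
        _ ≤ v * (m * a) := Nat.mul_le_mul h2.2.2.le h1.2.1.le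
        _ = v * m * a := by ring
    gcongr 1 + Real.log ?_
    rw [div_le_div_iff₀ hm0 hu0]
    exact_mod_cast h5

lemma brun_nonneg {P : Finset ℕ} {R : ℕ} (hR : Even R) (n : ℕ) : 0 ≤ brun P R n :=
  (sifted_nonneg P n).trans (sifted_le_brun P hR n)

lemma SieveRange.abs_brunSum_le {P : Finset ℕ} {R : ℕ} {Z E : ℝ} {X N : ℕ}
    (h : SieveRange P R Z E X) (hN : N ≤ X) {k : ℕ} (hk : 0 < k) :
    |brunSum P R N k| ≤ 2 * (N / k) * (Real.exp (-recipSum P) * E) + 8 * Z ^ R := by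
  have hZ : 0 ≤ Z := zero_le_one.trans h.one_le
  have hE : 0 ≤ E := zero_le_one.trans h.one_le_loss
  unfold brunSum
  rw [abs_of_nonneg (Finset.sum_nonneg fun _ _ => brun_nonneg h.even _)]
  by_cases hkN : k ≤ N
  · refine (h.sum_brun_le hk (hkN.trans hN) (N / k)).trans ?_
    have h1 : ((N / k : ℕ) : ℝ) ≤ N / k := Nat.cast_div_le
    gcongr
  · rw [Nat.div_eq_of_lt (by omega)]
    simp only [zero_lt_one, Finset.Icc_eq_empty_of_lt, Finset.sum_empty]
    positivity

lemma abs_partSum_head_le {P : Finset ℕ} {R : ℕ} {Z E : ℝ} {X N : ℕ} (h : SieveRange P R Z E X)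
    (hN : N ≤ X) {u v A B : ℕ} (hu : 1 ≤ u) (huv : u ≤ v) (hB : A * v ≤ B * u) :
    |partSum P R N u v (fun a => a ≤ A)|
      ≤ 2 * N * (Real.exp (-recipSum P) * E) *
          ((1 + Real.log A) * (1 + Real.log B) * (1 + Real.log (v / u)))
        + 8 * Z ^ R * (A * B * v) := by
  have hZ : 0 ≤ Z := zero_le_one.trans h.one_le
  have hE : 0 ≤ E := zero_le_one.trans h.one_le_loss
  set G := Real.exp (-recipSum P) * E with hG
  have hG0 : 0 ≤ G := by positivity
  set F : ℕ → ℕ → ℕ → ℝ := fun g b a => if g * a ∈ Ioo u v then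
    2 * N * G * (1 / (a : ℝ) * (1 / b) * (1 / g)) + 8 * Z ^ R else 0 with hF
  have hF0 : ∀ g b a, 0 ≤ F g b a := by
    intro g b a
    simp only [hF]
    split_ifs <;> positivity
  have hterm : ∀ g ∈ Icc 1 v, ∀ b ∈ Icc 1 v, ∀ a ∈ (Icc 1 v).filter (fun a => a ≤ A),
      |pairTerm P R N u v g b a| ≤ if b ∈ Icc 1 B then F g b a else 0 := by
    intro g hg b hb a ha
    rw [mem_filter, mem_Icc] at ha
    rw [mem_Icc] at hg hb
    unfold pairTerm
    by_cases hc : g * a ∈ Ioo u v ∧ g * b ∈ Ioo u v ∧ a.Coprime b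
    · rw [if_pos hc]
      have h1 := mem_Ioo.1 hc.1
      have h2 := mem_Ioo.1 hc.2.1
      have h3 : b ≤ B := by
        by_contra hlt
        have e1 : b * u ≤ b * (g * a) := Nat.mul_le_mul_left b h1.1.le
        have e2 : (g * b) * a < v * a := Nat.mul_lt_mul_of_pos_right h2.2 ha.1.1
        have e3 : v * a ≤ v * A := Nat.mul_le_mul_left v ha.2
        have e4 : B * u ≤ b * u := Nat.mul_le_mul_right u (by omega)
        have e5 : b * (g * a) = (g * b) * a := by ring
        have e6 : v * A = A * v := mul_comm _ _
        omega
      rw [if_pos (mem_Icc.2 ⟨hb.1, h3⟩)]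
      simp only [hF]
      rw [if_pos hc.1, abs_mul, abs_mul]
      have hk : 0 < g * b * a := Nat.mul_pos (Nat.mul_pos hg.1 hb.1) ha.1.1
      have h4 := h.abs_brunSum_le hN hk
      have h5 : |chi4 (g * a)| * |chi4 (g * b)| ≤ 1 :=
        mul_le_one₀ (abs_chi4_le_one _) (abs_nonneg _) (abs_chi4_le_one _)
      refine (mul_le_of_le_one_left (abs_nonneg _) h5).trans (h4.trans (le_of_eq ?_))
      rw [← hG]
      push_cast
      field_simp
    · rw [if_neg hc, abs_zero]
      split_ifs
      · exact hF0 g b a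
      · rfl
  have hsplit : |partSum P R N u v (fun a => a ≤ A)|
      ≤ ∑ a ∈ Icc 1 A, ∑ b ∈ Icc 1 B, ∑ g ∈ Icc 1 v, F g b a := by
    unfold partSum
    calc _ ≤ ∑ g ∈ Icc 1 v, ∑ b ∈ Icc 1 v, ∑ a ∈ (Icc 1 v).filter (fun a => a ≤ A),
          (if b ∈ Icc 1 B then F g b a else 0) := by
          refine (Finset.abs_sum_le_sum_abs _ _).trans (Finset.sum_le_sum fun g hg => ?_)
          refine (Finset.abs_sum_le_sum_abs _ _).trans (Finset.sum_le_sum fun b hb => ?_)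
          exact (Finset.abs_sum_le_sum_abs _ _).trans (Finset.sum_le_sum fun a ha =>
            hterm g hg b hb a ha)
      _ ≤ ∑ g ∈ Icc 1 v, ∑ b ∈ Icc 1 v, (if b ∈ Icc 1 B then ∑ a ∈ Icc 1 A, F g b a else 0) := by
          apply Finset.sum_le_sum
          intro g _
          apply Finset.sum_le_sum
          intro b _
          split_ifs
          · apply Finset.sum_le_sum_of_subset_of_nonneg
            · intro a ha
              rw [mem_filter, mem_Icc] at ha
              exact mem_Icc.2 ⟨ha.1.1, ha.2⟩
            · exact fun a _ _ => hF0 g b a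
          · rw [Finset.sum_const_zero]
      _ ≤ ∑ g ∈ Icc 1 v, ∑ b ∈ Icc 1 B, ∑ a ∈ Icc 1 A, F g b a := by
          apply Finset.sum_le_sum
          intro g _
          rw [← Finset.sum_filter]
          apply Finset.sum_le_sum_of_subset_of_nonneg
          · intro b hb
            exact (mem_filter.1 hb).2
          · exact fun b _ _ => Finset.sum_nonneg fun a _ => hF0 g b a
      _ = _ := by
          rw [Finset.sum_comm]
          simp_rw [Finset.sum_comm (s := Icc 1 v) (t := Icc 1 A)]
          rw [Finset.sum_comm]
  refine hsplit.trans ?_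
  have hg : ∀ a b : ℕ, ∑ g ∈ Icc 1 v, F g b a
      ≤ 2 * N * G * (1 + Real.log (v / u)) * (1 / (a : ℝ) * (1 / b)) + 8 * Z ^ R * v := by
    intro a b
    simp only [hF]
    rw [← Finset.sum_filter, Finset.sum_add_distrib, ← Finset.mul_sum, ← Finset.mul_sum]
    apply add_le_add
    · calc _ ≤ 2 * N * G * (1 / (a : ℝ) * (1 / b) * (1 + Real.log (v / u))) := by
            gcongr
            exact sum_inv_dilate_le hu huv
        _ = _ := by ring
    · rw [Finset.sum_const, nsmul_eq_mul, mul_comm]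
      apply mul_le_mul_of_nonneg_left _ (by positivity)
      have : #((Icc 1 v).filter (fun g => g * a ∈ Ioo u v)) ≤ v :=
        (Finset.card_filter_le _ _).trans (by simp)
      exact_mod_cast this
  calc _ ≤ ∑ a ∈ Icc 1 A, ∑ b ∈ Icc 1 B,
        (2 * N * G * (1 + Real.log (v / u)) * (1 / (a : ℝ) * (1 / b)) + 8 * Z ^ R * v) :=
        Finset.sum_le_sum fun a _ => Finset.sum_le_sum fun b _ => hg a b
    _ = 2 * N * G * (1 + Real.log (v / u)) *
        ((∑ a ∈ Icc 1 A, 1 / (a : ℝ)) * ∑ b ∈ Icc 1 B, 1 / (b : ℝ)) + 8 * Z ^ R * (A * B * v) := by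
        simp only [Finset.sum_add_distrib, Finset.sum_const, Nat.card_Icc, Nat.add_sub_cancel,
          nsmul_eq_mul]
        rw [Finset.sum_mul_sum, Finset.mul_sum]
        simp_rw [Finset.mul_sum]
        ring
    _ ≤ 2 * N * G * (1 + Real.log (v / u)) * ((1 + Real.log A) * (1 + Real.log B))
        + 8 * Z ^ R * (A * B * v) := by
        have hu0 : (0 : ℝ) < u := by exact_mod_cast hu
        have : (1 : ℝ) ≤ v / u := by
          rw [one_le_div hu0]
          exact_mod_cast huv
        have := Real.log_nonneg this
        have := one_add_log_nonneg A
        gcongr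
        · exact sum_inv_Icc_le A
        · exact sum_inv_Icc_le B
    _ = _ := by ring

/-- The weighted second moment of the character sum over divisors. -/
lemma SieveRange.sum_brun_charSum_sq_le {P : Finset ℕ} {R : ℕ} {Z E : ℝ} {X N : ℕ}
    (h : SieveRange P R Z E X) (hN : N ≤ X) {u v A A' B : ℕ} (hu : 1 ≤ u) (huv : u ≤ v)
    (hA : 0 < A) (hAA' : A ≤ A') (hB : A * v ≤ B * u) :
    ∑ n ∈ Icc 1 N, brun P R n * charSum u v n ^ 2
      ≤ 2 * N * (Real.exp (-recipSum P) * E) *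
          ((1 + Real.log A) * (1 + Real.log B) * (1 + Real.log (v / u)))
        + 8 * Z ^ R * (A * B * v)
        + (6 * Z ^ R * A' * (v * (1 + Real.log v)) +
          8 * (N / A) * Real.exp (2 * recipSum P) * (1 + Real.log v) ^ 3)
        + 24 * Z ^ R * (N / A') * (1 + Real.log v) ^ 3 := by
  rw [sum_brun_charSum_sq]
  have hsplit : ∑ g ∈ Icc 1 v, ∑ b ∈ Icc 1 v, ∑ a ∈ Icc 1 v, pairTerm P R N u v g b a
      = partSum P R N u v (fun a => a ≤ A) + partSum P R N u v (fun a => A < a ∧ a ≤ A')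
        + partSum P R N u v (fun a => A' < a) := by
    unfold partSum
    simp_rw [← Finset.sum_add_distrib]
    apply Finset.sum_congr rfl
    intro g _
    apply Finset.sum_congr rfl
    intro b _
    rw [Finset.sum_filter, Finset.sum_filter, Finset.sum_filter, ← Finset.sum_add_distrib,
      ← Finset.sum_add_distrib]
    apply Finset.sum_congr rfl
    intro a _
    rcases le_or_gt a A with h1 | h1
    · rw [if_pos h1, if_neg (by omega), if_neg (by omega)]
      ring
    · rcases le_or_gt a A' with h2 | h2
      · rw [if_neg (by omega), if_pos ⟨h1, h2⟩, if_neg (by omega)]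
        ring
      · rw [if_neg (by omega), if_neg (by omega), if_pos h2]
        ring
  rw [hsplit]
  have h1 := (le_abs_self _).trans (abs_partSum_head_le h hN hu huv hB)
  have h2 := (le_abs_self _).trans (abs_partSum_mid_le h N u v A' hA)
  have h3 := (le_abs_self _).trans (abs_partSum_tail_le h N u v (hA.trans_le hAA'))
  linarith

lemma abs_charSum_le_card (u v n : ℕ) : |charSum u v n| ≤ #{d ∈ Ioo u v | d ∣ n} := by
  calc |charSum u v n| ≤ ∑ d ∈ Ioo u v, |chi4 d * dvdOne d n| := Finset.abs_sum_le_sum_abs _ _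
    _ ≤ ∑ d ∈ Ioo u v, dvdOne d n := by
        apply Finset.sum_le_sum
        intro d _
        rw [abs_mul, abs_of_nonneg (dvdOne_nonneg d n)]
        exact mul_le_of_le_one_left (dvdOne_nonneg d n) (abs_chi4_le_one d)
    _ = #{d ∈ Ioo u v | d ∣ n} := by
        simp [dvdOne]

lemma one_le_pow_mul_thin {P : Finset ℕ} {K n : ℕ} (h : omegaIn P n < K) :
    1 ≤ (4 / 3 : ℝ) ^ K * thin P n := by
  rw [thin_eq]
  calc (1 : ℝ) = (4 / 3) ^ omegaIn P n * (3 / 4) ^ omegaIn P n := by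
        rw [← mul_pow]
        norm_num
    _ ≤ _ := by
        gcongr
        norm_num

/-- Numbers with few prime factors in `P` are handled by the divisor weight, the others by
the Cauchy–Schwarz inequality. -/
lemma sum_sifted_abs_charSum_le {P : Finset ℕ} {R : ℕ} (hR : Even R) (N u v K : ℕ) :
    ∑ n ∈ Icc 1 N, sifted P n * |charSum u v n|
      ≤ (4 / 3) ^ K * ∑ n ∈ Icc 1 N, sifted P n * thin P n * #{d ∈ Ioo u v | d ∣ n}
        + √((∑ n ∈ Icc 1 N, if K ≤ omegaIn P n then sifted P n else 0) *
            ∑ n ∈ Icc 1 N, brun P R n * charSum u v n ^ 2) := by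
  have hpt : ∀ n ∈ Icc 1 N, sifted P n * |charSum u v n|
      ≤ (4 / 3) ^ K * (sifted P n * thin P n * #{d ∈ Ioo u v | d ∣ n})
        + (if K ≤ omegaIn P n then √(sifted P n) else 0) * (√(sifted P n) * |charSum u v n|) := by
    intro n _
    have h0 := sifted_nonneg P n
    have h1 := thin_nonneg P n
    split_ifs with hk
    · rw [← mul_assoc (√_), Real.mul_self_sqrt h0]
      have : 0 ≤ (4 / 3 : ℝ) ^ K * (sifted P n * thin P n * #{d ∈ Ioo u v | d ∣ n}) := by positivity
      linarith
    · have h2 := one_le_pow_mul_thin (P := P) (not_le.1 hk)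
      have h3 := abs_charSum_le_card u v n
      calc sifted P n * |charSum u v n| ≤ sifted P n * #{d ∈ Ioo u v | d ∣ n} := by gcongr
        _ ≤ (4 / 3 : ℝ) ^ K * thin P n * (sifted P n * #{d ∈ Ioo u v | d ∣ n}) :=
            le_mul_of_one_le_left (by positivity) h2
        _ = _ := by ring
  refine (Finset.sum_le_sum hpt).trans ?_
  rw [Finset.sum_add_distrib, ← Finset.mul_sum]
  gcongr
  refine (Real.sum_mul_le_sqrt_mul_sqrt _ _ _).trans ?_
  rw [Real.sqrt_mul (Finset.sum_nonneg fun n _ => by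
    have := sifted_nonneg P n
    split_ifs <;> simp [this])]
  gcongr with n _ n _
  · split_ifs
    · rw [Real.sq_sqrt (sifted_nonneg P n)]
    · simp
  · rw [mul_pow, Real.sq_sqrt (sifted_nonneg P n), sq_abs]
    gcongr
    exact sifted_le_brun P hR n

lemma sum_divisors_eq_charSum {lo hi : ℝ} (hlo : 0 ≤ lo) {n : ℕ} (hn : n ≠ 0) :
    ∑ d ∈ n.divisors, (if lo < (d : ℝ) ∧ (d : ℝ) < hi then chi4 d else 0)
      = charSum ⌊lo⌋₊ ⌈hi⌉₊ n := by
  unfold charSum dvdOne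
  simp_rw [mul_ite, mul_one, mul_zero]
  rw [← Finset.sum_filter, ← Finset.sum_filter]
  apply Finset.sum_congr _ fun _ _ => rfl
  ext d
  simp only [mem_filter, Nat.mem_divisors, mem_Ioo, Nat.floor_lt hlo, Nat.lt_ceil]
  tauto

lemma sifted_eq_one_of_prime {P : Finset ℕ} {Z : ℕ} (hP : ∀ q ∈ P, q.Prime ∧ q ≤ Z) {n : ℕ}
    (hn : (n + 1).Prime) (hZ : Z < n + 1) : sifted P n = 1 := by
  apply Finset.prod_eq_one
  intro q hq
  rw [dvdOne_eq_zero, sub_zero]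
  intro hdvd
  have := (Nat.prime_dvd_prime_iff_eq (hP q hq).1 hn).1 hdvd
  have := (hP q hq).2
  omega

/-- Passing from the primes up to `N` to the sifted integers. -/
lemma sum_prime_abs_sum_divisors_le {P : Finset ℕ} {Z : ℕ} (hP : ∀ q ∈ P, q.Prime ∧ q ≤ Z)
    {lo hi : ℝ} (hlo : 0 ≤ lo) (N : ℕ) :
    (∑ p ∈ range (N + 1), if p.Prime then |∑ d ∈ (p - 1).divisors,
        if lo < (d : ℝ) ∧ (d : ℝ) < hi then chi4 d else 0| else 0)
      ≤ (Z : ℝ) ^ 2 + ∑ n ∈ Icc 1 N, sifted P n * |charSum ⌊lo⌋₊ ⌈hi⌉₊ n| := by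
  set s := charSum ⌊lo⌋₊ ⌈hi⌉₊ with hs
  rw [Finset.sum_range_succ', if_neg Nat.not_prime_zero, add_zero]
  have hpt : ∀ n ∈ range N, (if (n + 1).Prime then |∑ d ∈ (n + 1 - 1).divisors,
      if lo < (d : ℝ) ∧ (d : ℝ) < hi then chi4 d else 0| else 0)
      ≤ (if n < Z then (Z : ℝ) else 0) + if n ∈ Icc 1 N then sifted P n * |s n| else 0 := by
    intro n hn
    have h0 : 0 ≤ if n ∈ Icc 1 N then sifted P n * |s n| else 0 := by
      have := mul_nonneg (sifted_nonneg P n) (abs_nonneg (s n))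
      split_ifs <;> simp [this]
    have h1 : (0 : ℝ) ≤ if n < Z then (Z : ℝ) else 0 := by
      split_ifs <;> simp
    by_cases hp : (n + 1).Prime
    · rw [if_pos hp]
      have hn0 : n ≠ 0 := by
        rintro rfl
        exact Nat.not_prime_one hp
      rw [Nat.add_sub_cancel, sum_divisors_eq_charSum hlo hn0]
      rcases lt_or_ge n Z with hZ | hZ
      · rw [if_pos hZ]
        have hc : #{d ∈ Ioo ⌊lo⌋₊ ⌈hi⌉₊ | d ∣ n} ≤ #(n.divisors) := by
          apply Finset.card_le_card
          intro d hd
          rw [mem_filter] at hd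
          exact Nat.mem_divisors.2 ⟨hd.2, hn0⟩
        have hc2 := hc.trans ((Nat.card_divisors_le_self n).trans hZ.le)
        have hc3 : (#{d ∈ Ioo ⌊lo⌋₊ ⌈hi⌉₊ | d ∣ n} : ℝ) ≤ Z := by exact_mod_cast hc2
        have := abs_charSum_le_card ⌊lo⌋₊ ⌈hi⌉₊ n
        linarith
      · rw [if_pos (mem_Icc.2 ⟨Nat.pos_of_ne_zero hn0, (mem_range.1 hn).le⟩),
          sifted_eq_one_of_prime hP hp (by omega), one_mul]
        linarith
    · rw [if_neg hp]
      exact add_nonneg h1 h0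
  refine (Finset.sum_le_sum hpt).trans ?_
  rw [Finset.sum_add_distrib]
  apply add_le_add
  · rw [← Finset.sum_filter, Finset.sum_const, nsmul_eq_mul, sq]
    gcongr
    calc #{n ∈ range N | n < Z} ≤ #(range Z) := by
          apply Finset.card_le_card
          intro n hn
          simp only [mem_filter, mem_range] at hn ⊢
          exact hn.2
      _ = Z := card_range Z
  · rw [← Finset.sum_filter]
    apply Finset.sum_le_sum_of_subset_of_nonneg
    · intro n hn
      exact (mem_filter.1 hn).2
    · intro n _ _
      exact mul_nonneg (sifted_nonneg P n) (abs_nonneg _)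

lemma card_primeFactors_mul_log_two_le {c : ℕ} (hc : c ≠ 0) :
    #c.primeFactors * Real.log 2 ≤ Real.log c := by
  rw [← Real.log_pow]
  apply Real.log_le_log (by positivity)
  have h1 : 2 ^ #c.primeFactors ≤ ∏ p ∈ c.primeFactors, p :=
    Finset.pow_card_le_prod _ _ _ fun p hp => (Nat.prime_of_mem_primeFactors hp).two_le
  have h2 := Nat.le_of_dvd (Nat.pos_of_ne_zero hc) (Nat.prod_primeFactors_dvd c)
  exact_mod_cast h1.trans h2

/-- The reciprocals of the prime divisors of an integer up to `N` have sum at most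
`log log log N + O(1)`. -/
lemma exists_sum_inv_prime_dvd_le : ∃ C : ℝ, 0 ≤ C ∧ ∀ N : ℕ, 3 ≤ Real.log N →
    ∀ P : Finset ℕ, (∀ p ∈ P, p.Prime) → ∀ c, 1 ≤ c → c ≤ N →
      ∑ p ∈ P, 1 / (p : ℝ) * dvdOne p c ≤ Real.log (Real.log (Real.log N)) + C := by
  obtain ⟨C, hC, hM⟩ := exists_sum_inv_prime_le
  refine ⟨C + 2, by linarith, fun N hN P hP c hc hcN => ?_⟩
  set L := Real.log N with hL
  set M := ⌊L⌋₊ with hMdef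
  have hM3 : 3 ≤ M := Nat.le_floor (by exact_mod_cast hN)
  have hML : (M : ℝ) ≤ L := Nat.floor_le (by linarith)
  have hpt : ∀ p ∈ P, 1 / (p : ℝ) * dvdOne p c
      ≤ (if p ∈ Nat.primesLE M then 1 / (p : ℝ) else 0) + if p ∈ c.primeFactors then 1 / L else 0 := by
    intro p hp
    have hpp := hP p hp
    have hp0 : (0 : ℝ) < p := by exact_mod_cast hpp.pos
    have hA : (0 : ℝ) ≤ if p ∈ Nat.primesLE M then 1 / (p : ℝ) else 0 := by
      split_ifs <;> positivity
    have hB : (0 : ℝ) ≤ if p ∈ c.primeFactors then 1 / L else 0 := by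
      split_ifs
      · apply div_nonneg zero_le_one
        linarith
      · rfl
    by_cases hd : p ∣ c
    · rw [dvdOne_eq_one hd, mul_one]
      rcases le_or_gt p M with hpM | hpM
      · rw [if_pos (Nat.mem_primesLE.2 ⟨hpM, hpp⟩)]
        linarith
      · rw [if_pos (Nat.mem_primeFactors.2 ⟨hpp, hd, by omega⟩)]
        have : L < p := (Nat.floor_lt (by linarith)).1 hpM
        have : 1 / (p : ℝ) ≤ 1 / L := one_div_le_one_div_of_le (by linarith) this.le
        linarith
    · rw [dvdOne_eq_zero hd, mul_zero]
      exact add_nonneg hA hB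
  refine (Finset.sum_le_sum hpt).trans ?_
  rw [Finset.sum_add_distrib]
  have h1 : ∑ p ∈ P, (if p ∈ Nat.primesLE M then 1 / (p : ℝ) else 0) ≤ Real.log (Real.log L) + C := by
    calc ∑ p ∈ P, (if p ∈ Nat.primesLE M then 1 / (p : ℝ) else 0)
        = ∑ p ∈ P with p ∈ Nat.primesLE M, 1 / (p : ℝ) := (Finset.sum_filter _ _).symm
      _ ≤ ∑ p ∈ Nat.primesLE M, 1 / (p : ℝ) := by
          apply Finset.sum_le_sum_of_subset_of_nonneg
          · intro p hp
            exact (mem_filter.1 hp).2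
          · intro p _ _
            positivity
      _ ≤ Real.log (Real.log M) + C := hM M (by omega)
      _ ≤ Real.log (Real.log L) + C := by
          have : (1 : ℝ) < M := by exact_mod_cast (by omega : 1 < M)
          have := Real.log_pos this
          gcongr
  have h2 : ∑ p ∈ P, (if p ∈ c.primeFactors then 1 / L else 0) ≤ 2 := by
    calc ∑ p ∈ P, (if p ∈ c.primeFactors then 1 / L else 0)
        = #{p ∈ P | p ∈ c.primeFactors} * (1 / L) := by
          rw [← Finset.sum_filter, Finset.sum_const, nsmul_eq_mul]
      _ ≤ #c.primeFactors * (1 / L) := by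
          have : 0 ≤ 1 / L := div_nonneg zero_le_one (by linarith)
          gcongr
          intro p hp
          exact (mem_filter.1 hp).2
      _ ≤ 2 := by
          rw [mul_one_div, div_le_iff₀ (by linarith)]
          have ha := card_primeFactors_mul_log_two_le (c := c) (by omega)
          have hb : Real.log c ≤ L := Real.log_le_log (by exact_mod_cast hc) (by exact_mod_cast hcN)
          have hl := Real.log_two_gt_d9
          have : (0 : ℝ) ≤ #c.primeFactors := Nat.cast_nonneg _
          nlinarith
  linarith

/-- The primes used for sieving. -/
def sievePrimes (Z : ℕ) : Finset ℕ := (Nat.primesLE Z).erase 2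

lemma mem_sievePrimes {Z p : ℕ} (hp : p ∈ sievePrimes Z) : p.Prime ∧ p ≤ Z ∧ Odd p := by
  have h := Finset.mem_erase.1 hp
  have h2 := Nat.mem_primesLE.1 h.2
  exact ⟨h2.2, h2.1, h2.2.odd_of_ne_two h.1⟩

lemma card_sievePrimes_le (Z : ℕ) : #(sievePrimes Z) ≤ Z := by
  calc #(sievePrimes Z) ≤ #(Icc 1 Z) := by
        apply Finset.card_le_card
        intro p hp
        have := mem_sievePrimes hp
        exact mem_Icc.2 ⟨this.1.pos, this.2.1⟩
    _ = Z := by simp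

lemma exists_abs_recipSum_sub_le : ∃ C : ℝ, 0 ≤ C ∧ ∀ Z : ℕ, 2 ≤ Z →
    |recipSum (sievePrimes Z) - Real.log (Real.log Z)| ≤ C := by
  obtain ⟨C, hC, hM⟩ := exists_sum_inv_prime_le
  refine ⟨C + 2, by linarith, fun Z hZ => ?_⟩
  have h1 := hM Z hZ
  have h2 := log_log_le_sum_inv_prime Z hZ
  have h3 : recipSum (sievePrimes Z) + 1 / 2 = ∑ p ∈ Nat.primesLE Z, (1 : ℝ) / p := by
    have := Finset.sum_erase_add (Nat.primesLE Z) (fun p => (1 : ℝ) / p)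
      (Nat.mem_primesLE.2 ⟨hZ, Nat.prime_two⟩)
    simpa [recipSum, sievePrimes] using this
  rw [abs_le]
  constructor <;> linarith

lemma eventually_log_le {ε : ℝ} (hε : 0 < ε) (a b : ℝ) :
    ∀ᶠ x : ℝ in Filter.atTop, a * Real.log x + b ≤ ε * x := by
  have h : (fun x : ℝ => a * Real.log x + b) =o[Filter.atTop] fun x : ℝ => x :=
    (Real.isLittleO_log_id_atTop.const_mul_left a).add (Asymptotics.isLittleO_const_id_atTop b)
  filter_upwards [h.bound hε, Filter.eventually_ge_atTop 0] with x hx hx0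
  rw [Real.norm_eq_abs, Real.norm_eq_abs, abs_of_nonneg hx0] at hx
  exact (le_abs_self _).trans hx

lemma tendsto_log_natCast : Filter.Tendsto (fun N : ℕ => Real.log N) Filter.atTop Filter.atTop :=
  Real.tendsto_log_atTop.comp tendsto_natCast_atTop_atTop

lemma tendsto_log_log_natCast :
    Filter.Tendsto (fun N : ℕ => Real.log (Real.log N)) Filter.atTop Filter.atTop :=
  Real.tendsto_log_atTop.comp tendsto_log_natCast

lemma exp_sub_one_le {x : ℝ} (hx : 1 ≤ x) : Real.exp (x - 1) ≤ Real.exp x - 1 := by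
  have h1 : Real.exp x = Real.exp (x - 1) * Real.exp 1 := by
    rw [← Real.exp_add]
    ring_nf
  have h2 := Real.exp_one_gt_d9
  have h3 : 1 ≤ Real.exp (x - 1) := Real.one_le_exp (by linarith)
  nlinarith

/-- The sieving limit attached to `N`. -/
def sieveLimit (N : ℕ) : ℕ := ⌊Real.exp (Real.exp (999 / 1000 * Real.log (Real.log N)))⌋₊

/-- The sieving level attached to `N`. -/
def sieveLevel (N : ℕ) : ℕ := 2 * ⌈5 * Real.log (Real.log N)⌉₊

lemma sieveLimit_le (N : ℕ) :
    (sieveLimit N : ℝ) ≤ Real.exp (Real.exp (999 / 1000 * Real.log (Real.log N))) :=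
  Nat.floor_le (Real.exp_pos _).le

lemma le_log_sieveLimit {N : ℕ} (hN : 2 ≤ Real.log (Real.log N)) :
    2 ≤ sieveLimit N ∧
      Real.exp (999 / 1000 * Real.log (Real.log N) - 1) ≤ Real.log (sieveLimit N) := by
  set ℓ := Real.log (Real.log N)
  have h1 : 1 ≤ 999 / 1000 * ℓ := by linarith
  have h2 := exp_sub_one_le h1
  have h3 : 2 ≤ Real.exp (999 / 1000 * ℓ) := by
    have := Real.add_one_le_exp (999 / 1000 * ℓ)
    linarith
  have h4 := exp_sub_one_le (le_trans (by norm_num) h3)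
  have h5 : Real.exp (Real.exp (999 / 1000 * ℓ)) - 1 ≤ sieveLimit N := by
    have := Nat.lt_floor_add_one (Real.exp (Real.exp (999 / 1000 * ℓ)))
    change _ < (sieveLimit N : ℝ) + 1 at this
    linarith
  constructor
  · have h6 := Real.exp_one_gt_d9
    have h7 : Real.exp 1 ≤ Real.exp (Real.exp (999 / 1000 * ℓ) - 1) :=
      Real.exp_le_exp.2 (by linarith)
    have : (1 : ℝ) < sieveLimit N := by linarith
    exact_mod_cast this
  · refine h2.trans ?_
    rw [← Real.log_exp (Real.exp (999 / 1000 * ℓ) - 1)]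
    exact Real.log_le_log (Real.exp_pos _) (h4.trans h5)

lemma abs_log_log_sieveLimit_sub_le {N : ℕ} (hN : 2 ≤ Real.log (Real.log N)) :
    |Real.log (Real.log (sieveLimit N)) - 999 / 1000 * Real.log (Real.log N)| ≤ 1 := by
  obtain ⟨h2, h1⟩ := le_log_sieveLimit hN
  set ℓ := Real.log (Real.log N)
  have hZ : (0 : ℝ) < sieveLimit N := by
    exact_mod_cast (by omega : 0 < sieveLimit N)
  have h3 : Real.log (sieveLimit N) ≤ Real.exp (999 / 1000 * ℓ) := by
    rw [← Real.log_exp (Real.exp (999 / 1000 * ℓ))]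
    exact Real.log_le_log hZ (sieveLimit_le N)
  have h4 : 0 < Real.log (sieveLimit N) := (Real.exp_pos _).trans_le h1
  have h5 := (Real.le_log_iff_exp_le h4).2 h1
  have h6 := (Real.log_le_iff_le_exp h4).2 h3
  rw [abs_le]
  constructor <;> linarith

lemma eventually_sieveRange : ∀ᶠ N : ℕ in Filter.atTop,
    SieveRange (sievePrimes (sieveLimit N)) (sieveLevel N) (sieveLimit N)
      (Real.exp (1 / 1000 * Real.log (Real.log N))) N ∧
    998 / 1000 * Real.log (Real.log N) ≤ recipSum (sievePrimes (sieveLimit N)) ∧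
    recipSum (sievePrimes (sieveLimit N)) ≤ Real.log (Real.log N) := by
  obtain ⟨C₁, hC₁, h₁⟩ := exists_sum_inv_prime_dvd_le
  obtain ⟨C₂, hC₂, h₂⟩ := exists_abs_recipSum_sub_le
  filter_upwards [tendsto_log_natCast.eventually_ge_atTop 3,
    tendsto_log_log_natCast.eventually_ge_atTop 2,
    tendsto_log_log_natCast.eventually_ge_atTop (1000 * (C₂ + 1)),
    tendsto_log_log_natCast.eventually (eventually_log_le (by norm_num : (0 : ℝ) < 1 / 1000) 2
      (2 * C₁))] with N hL hℓ hℓ2 hloss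
  obtain ⟨hZ, -⟩ := le_log_sieveLimit hℓ
  have hS := abs_le.1 (h₂ _ hZ)
  have hS2 := abs_le.1 (abs_log_log_sieveLimit_sub_le hℓ)
  set ℓ := Real.log (Real.log N)
  have hup : recipSum (sievePrimes (sieveLimit N)) ≤ ℓ := by linarith
  refine ⟨⟨fun p hp => (mem_sievePrimes hp).1, fun p hp => (mem_sievePrimes hp).2.2,
    by exact_mod_cast (by omega : 1 ≤ sieveLimit N), by exact_mod_cast card_sievePrimes_le _,
    even_two_mul _, ?_, Real.one_le_exp (by positivity), ?_⟩, by linarith, hup⟩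
  · have := Nat.le_ceil (5 * ℓ)
    change _ ≤ ((2 * ⌈5 * ℓ⌉₊ : ℕ) : ℝ)
    push_cast
    linarith
  · intro c hc hcN
    apply Real.exp_le_exp.2
    have := h₁ N hL (sievePrimes (sieveLimit N)) (fun p hp => (mem_sievePrimes hp).1) c hc hcN
    linarith

/-- The threshold for the number of prime factors attached to `N`. -/
def omegaLevel (N : ℕ) : ℕ := ⌈3 / 2 * Real.log (Real.log N)⌉₊

lemma eventually_sieveLimit_pow_le : ∀ᶠ N : ℕ in Filter.atTop, ∀ k ≤ sieveLevel N + omegaLevel N,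
    (sieveLimit N : ℝ) ^ k ≤ Real.exp (1 / 100 * Real.log N) := by
  filter_upwards [tendsto_log_natCast.eventually_ge_atTop 3,
    tendsto_log_log_natCast.eventually_ge_atTop 2,
    tendsto_log_log_natCast.eventually (eventually_log_le (by norm_num : (0 : ℝ) < 1 / 1000) 1
      (Real.log 2000))] with N hL hℓ hlog k hk
  have hLe : Real.log N = Real.exp (Real.log (Real.log N)) := (Real.exp_log (by linarith)).symm
  have hlim := sieveLimit_le N
  have hk2 : (k : ℝ) ≤ 20 * Real.log (Real.log N) := by
    have h1 : (k : ℝ) ≤ 2 * ⌈5 * Real.log (Real.log N)⌉₊ + ⌈3 / 2 * Real.log (Real.log N)⌉₊ := by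
      exact_mod_cast hk
    have h2 := Nat.ceil_lt_add_one (by linarith : 0 ≤ 5 * Real.log (Real.log N))
    have h3 := Nat.ceil_lt_add_one (by linarith : 0 ≤ 3 / 2 * Real.log (Real.log N))
    linarith
  set ℓ := Real.log (Real.log N)
  calc (sieveLimit N : ℝ) ^ k ≤ Real.exp (Real.exp (999 / 1000 * ℓ)) ^ k := by gcongr
    _ = Real.exp (k * Real.exp (999 / 1000 * ℓ)) := (Real.exp_nat_mul _ _).symm
    _ ≤ Real.exp (1 / 100 * Real.log N) := by
        apply Real.exp_le_exp.2
        have h4 : 2000 * ℓ ≤ Real.exp (1 / 1000 * ℓ) := by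
          rw [← Real.exp_log (by linarith : 0 < 2000 * ℓ), Real.log_mul (by norm_num) (by linarith)]
          apply Real.exp_le_exp.2
          linarith
        calc k * Real.exp (999 / 1000 * ℓ)
            ≤ (1 / 100 * Real.exp (1 / 1000 * ℓ)) * Real.exp (999 / 1000 * ℓ) := by
              gcongr
              linarith
          _ = 1 / 100 * Real.log N := by
              rw [hLe, mul_assoc, ← Real.exp_add]
              ring_nf

lemma eventually_le_exp {ε : ℝ} (hε : 0 < ε) (a b : ℝ) :
    ∀ᶠ x : ℝ in Filter.atTop, a * x + b ≤ Real.exp (ε * x) := by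
  filter_upwards [eventually_log_le hε 1 (Real.log (|a| + |b| + 1)),
    Filter.eventually_ge_atTop 1] with x hx hx1
  have ha := le_abs_self a
  have hb := le_abs_self b
  have ha0 := abs_nonneg a
  have hb0 := abs_nonneg b
  calc a * x + b ≤ (|a| + |b| + 1) * x := by nlinarith
    _ = Real.exp (Real.log (|a| + |b| + 1) + Real.log x) := by
        rw [Real.exp_add, Real.exp_log (by positivity), Real.exp_log (by positivity)]
    _ ≤ Real.exp (ε * x) := Real.exp_le_exp.2 (by linarith)

lemma natCeil_exp_le {x : ℝ} (hx : 0 ≤ x) : (⌈Real.exp x⌉₊ : ℝ) ≤ Real.exp (x + 1) := by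
  have h1 := Nat.ceil_lt_add_one (Real.exp_pos x).le
  have h2 := exp_sub_one_le (by linarith : 1 ≤ x + 1)
  rw [add_sub_cancel_right] at h2
  have h3 := Real.one_le_exp hx
  have h4 : Real.exp (x + 1) = Real.exp x * Real.exp 1 := Real.exp_add _ _
  have h5 := Real.exp_one_gt_d9
  nlinarith

lemma le_natFloor_exp {x : ℝ} (hx : 1 ≤ x) : Real.exp (x - 1) ≤ ⌊Real.exp x⌋₊ := by
  have h1 := Nat.lt_floor_add_one (Real.exp x)
  have h2 := exp_sub_one_le hx
  linarith

/-- The numerical constraints under which the moment bounds combine, in terms of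
`L = log N` and `ℓ = log log N`. -/
structure Scales (L ℓ : ℝ) (u v A A' B : ℕ) : Prop where
  two_le : 2 ≤ ℓ
  le_exp : 200 * ℓ ≤ L
  one_le : 1 ≤ u
  le : u ≤ v
  le_left : Real.exp (49 / 100 * L) ≤ u
  right_le : (v : ℝ) ≤ Real.exp (51 / 100 * L)
  log_ratio : 1 + Real.log (v / u) ≤ Real.exp (1 / 1000 * ℓ)
  log_right : 1 + Real.log v ≤ Real.exp (2 * ℓ)
  cut_pos : 0 < A
  le_cut : Real.exp (10 * ℓ) ≤ A
  cut_le : (A : ℝ) ≤ Real.exp (1 / 100 * L)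
  log_cut : 1 + Real.log A ≤ Real.exp (1 / 1000 * ℓ)
  cut_le_cut : A ≤ A'
  le_cut' : Real.exp (24 / 100 * L) ≤ A'
  cut_le' : (A' : ℝ) ≤ Real.exp (25 / 100 * L)
  mul_le : A * v ≤ B * u
  pos_dual : 1 ≤ B
  dual_le : (B : ℝ) ≤ Real.exp (1 / 100 * L)
  log_dual : 1 + Real.log B ≤ Real.exp (1 / 1000 * ℓ)

lemma scales_of_bounds {ω L ℓ : ℝ} (hω : 0 < ω) (hLℓ : L = Real.exp ℓ) (h2 : 2 ≤ ℓ)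
    (h3 : (2000 + 200 * ω) * ℓ + 1000 ≤ L)
    (h4 : (10 + 2 * ω) * ℓ + 5 ≤ Real.exp (1 / 1000 * ℓ)) :
    Scales L ℓ ⌊Real.exp (L / 2 - ω * ℓ)⌋₊ ⌈Real.exp (L / 2 + ω * ℓ)⌉₊ ⌈Real.exp (10 * ℓ)⌉₊
      ⌊Real.exp (25 / 100 * L)⌋₊
      ⌈(⌈Real.exp (10 * ℓ)⌉₊ * ⌈Real.exp (L / 2 + ω * ℓ)⌉₊ : ℝ) / ⌊Real.exp (L / 2 - ω * ℓ)⌋₊⌉₊ := by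
  have hωℓ : 0 < ω * ℓ := by positivity
  have hu := le_natFloor_exp (by nlinarith : 1 ≤ L / 2 - ω * ℓ)
  have hv := natCeil_exp_le (by nlinarith : 0 ≤ L / 2 + ω * ℓ)
  have hv' := Nat.le_ceil (Real.exp (L / 2 + ω * ℓ))
  have hA := natCeil_exp_le (by linarith : 0 ≤ 10 * ℓ)
  have hA0 := Nat.le_ceil (Real.exp (10 * ℓ))
  have hA' := le_natFloor_exp (by linarith : 1 ≤ 25 / 100 * L)
  have hA0' := Nat.floor_le (Real.exp_pos (25 / 100 * L)).le
  have huv : ⌊Real.exp (L / 2 - ω * ℓ)⌋₊ ≤ ⌈Real.exp (L / 2 + ω * ℓ)⌉₊ := by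
    apply (Nat.floor_le_ceil _).trans
    apply Nat.ceil_le_ceil
    apply Real.exp_le_exp.2
    linarith
  have hu0 : (0 : ℝ) < ⌊Real.exp (L / 2 - ω * ℓ)⌋₊ := (Real.exp_pos _).trans_le hu
  have hv0 : (0 : ℝ) < ⌈Real.exp (L / 2 + ω * ℓ)⌉₊ := (Real.exp_pos _).trans_le hv'
  have hA1 : (0 : ℝ) < ⌈Real.exp (10 * ℓ)⌉₊ := (Real.exp_pos _).trans_le hA0
  set u := ⌊Real.exp (L / 2 - ω * ℓ)⌋₊
  set v := ⌈Real.exp (L / 2 + ω * ℓ)⌉₊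
  set A := ⌈Real.exp (10 * ℓ)⌉₊
  set A' := ⌊Real.exp (25 / 100 * L)⌋₊
  have hratio : (v : ℝ) / u ≤ Real.exp (2 * (ω * ℓ) + 2) := by
    rw [div_le_iff₀ hu0]
    calc (v : ℝ) ≤ Real.exp (2 * (ω * ℓ) + 2) * Real.exp (L / 2 - ω * ℓ - 1) := by
          rw [← Real.exp_add]
          convert hv using 2
          ring
      _ ≤ _ := by gcongr
  have hB0 : (A * v : ℝ) / u ≤ Real.exp ((10 + 2 * ω) * ℓ + 3) := by
    calc (A * v : ℝ) / u = A * (v / u) := by ring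
      _ ≤ Real.exp (10 * ℓ + 1) * Real.exp (2 * (ω * ℓ) + 2) := by gcongr
      _ = _ := by
          rw [← Real.exp_add]
          ring_nf
  have hB : (⌈(A * v : ℝ) / u⌉₊ : ℝ) ≤ Real.exp ((10 + 2 * ω) * ℓ + 4) := by
    have := natCeil_exp_le (by nlinarith : 0 ≤ (10 + 2 * ω) * ℓ + 3)
    refine le_trans ?_ (this.trans (le_of_eq (by ring_nf)))
    exact_mod_cast Nat.ceil_le_ceil hB0
  have hBpos : 0 < ⌈(A * v : ℝ) / u⌉₊ := Nat.ceil_pos.2 (by positivity)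
  have hloglin : ∀ {x y : ℝ}, 0 < x → x ≤ Real.exp y → Real.log x ≤ y := fun hx hxy =>
    (Real.log_le_iff_le_exp hx).2 hxy
  refine ⟨h2, by nlinarith, by exact_mod_cast hu0, huv, ?_, ?_, ?_, ?_, by exact_mod_cast hA1, hA0,
    ?_, ?_, ?_, ?_, hA0', ?_, hBpos, ?_, ?_⟩
  · exact (Real.exp_le_exp.2 (by linarith)).trans hu
  · exact hv.trans (Real.exp_le_exp.2 (by linarith))
  · have := hloglin (by positivity) hratio
    linarith
  · have h5 := hloglin hv0 hv
    have h6 : Real.exp (2 * ℓ) = L * L := by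
      rw [hLℓ, ← Real.exp_add]
      ring_nf
    rw [h6]
    nlinarith
  · exact hA.trans (Real.exp_le_exp.2 (by linarith))
  · have := hloglin hA1 hA
    linarith
  · have : (A : ℝ) ≤ A' := hA.trans ((Real.exp_le_exp.2 (by linarith)).trans hA')
    exact_mod_cast this
  · exact (Real.exp_le_exp.2 (by linarith)).trans hA'
  · have := Nat.le_ceil ((A * v : ℝ) / u)
    rw [div_le_iff₀ hu0] at this
    exact_mod_cast this
  · exact hB.trans (Real.exp_le_exp.2 (by linarith))
  · have := hloglin (by exact_mod_cast hBpos) hB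
    linarith

lemma log_three_halves_ge : 101 / 250 ≤ Real.log (3 / 2) := by
  have h1 : (7 : ℕ) * Real.log 2 ≤ (12 : ℕ) * Real.log (3 / 2) := by
    rw [← Real.log_pow, ← Real.log_pow]
    apply Real.log_le_log <;> norm_num
  have h2 := Real.log_two_gt_d9
  push_cast at h1
  linarith

lemma log_four_thirds_le : Real.log (4 / 3) ≤ 22 / 75 := by
  have h1 : Real.log (4 / 3) = Real.log 2 - Real.log (3 / 2) := by
    rw [← Real.log_div (by norm_num) (by norm_num)]
    norm_num
  have := Real.log_two_lt_d9
  have := log_three_halves_ge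
  linarith

lemma four_thirds_pow_le {ℓ : ℝ} (hℓ : 0 ≤ ℓ) :
    (4 / 3 : ℝ) ^ ⌈3 / 2 * ℓ⌉₊ ≤ 2 * Real.exp (11 / 25 * ℓ) := by
  have h1 := Nat.ceil_lt_add_one (by positivity : 0 ≤ 3 / 2 * ℓ)
  have h2 := log_four_thirds_le
  have h0 : 0 ≤ Real.log (4 / 3 : ℝ) := Real.log_nonneg (by norm_num)
  calc (4 / 3 : ℝ) ^ ⌈3 / 2 * ℓ⌉₊ = Real.exp (⌈3 / 2 * ℓ⌉₊ * Real.log (4 / 3)) := by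
        rw [Real.exp_nat_mul, Real.exp_log (by norm_num)]
    _ ≤ Real.exp (Real.log (4 / 3) + 11 / 25 * ℓ) := by
        apply Real.exp_le_exp.2
        nlinarith
    _ ≤ _ := by
        rw [Real.exp_add, Real.exp_log (by norm_num)]
        gcongr
        norm_num

lemma le_three_halves_pow (ℓ : ℝ) :
    Real.exp (303 / 500 * ℓ) ≤ (3 / 2 : ℝ) ^ ⌈3 / 2 * ℓ⌉₊ := by
  have h1 := Nat.le_ceil (3 / 2 * ℓ)
  have h2 := log_three_halves_ge
  calc Real.exp (303 / 500 * ℓ) ≤ Real.exp (⌈3 / 2 * ℓ⌉₊ * Real.log (3 / 2)) := by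
        apply Real.exp_le_exp.2
        have : (0 : ℝ) ≤ ⌈3 / 2 * ℓ⌉₊ := Nat.cast_nonneg _
        nlinarith
    _ = _ := by
        rw [Real.exp_nat_mul, Real.exp_log (by norm_num)]

section Bounds

variable {L ℓ S W : ℝ} {u v A A' B : ℕ}

lemma first_bound (hs : Scales L ℓ u v A A' B) (hS : 998 / 1000 * ℓ ≤ S) (hW0 : 0 ≤ W)
    (hW : W ≤ Real.exp (1 / 100 * L)) :
    2 * Real.exp L * (Real.exp (-(5 / 4 * S)) * Real.exp (1 / 1000 * ℓ)) *
      ((2 * Real.exp (-(1 / 4 * S)) + 8 * W / u) * (1 + Real.log (v / u))) + 8 * W * v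
      ≤ 28 * Real.exp (L - 149 / 100 * ℓ) := by
  have h2 := hs.two_le
  have hL := hs.le_exp
  have hu : (0 : ℝ) < u := (Real.exp_pos _).trans_le hs.le_left
  have hlog : 0 ≤ Real.log ((v : ℝ) / u) := by
    apply Real.log_nonneg
    rw [one_le_div hu]
    exact_mod_cast hs.le
  have h3 : W / u ≤ Real.exp (-(2495 / 10000 * ℓ)) := by
    rw [div_le_iff₀ hu]
    calc W ≤ Real.exp (-(2495 / 10000 * ℓ)) * Real.exp (49 / 100 * L) := by
          refine hW.trans ?_
          rw [← Real.exp_add]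
          apply Real.exp_le_exp.2
          linarith
      _ ≤ _ := by
          gcongr
          exact hs.le_left
  have h4 : W * v ≤ Real.exp (L - 149 / 100 * ℓ) := by
    calc W * v ≤ Real.exp (1 / 100 * L) * Real.exp (51 / 100 * L) := by
          gcongr
          exact hs.right_le
      _ ≤ _ := by
          rw [← Real.exp_add]
          apply Real.exp_le_exp.2
          linarith
  have h5 : Real.exp (-(5 / 4 * S)) ≤ Real.exp (-(12475 / 10000 * ℓ)) :=
    Real.exp_le_exp.2 (by linarith)
  have h6 : Real.exp (-(1 / 4 * S)) ≤ Real.exp (-(2495 / 10000 * ℓ)) :=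
    Real.exp_le_exp.2 (by linarith)
  have h7 : 2 * Real.exp (-(1 / 4 * S)) + 8 * W / u ≤ 10 * Real.exp (-(2495 / 10000 * ℓ)) := by
    rw [mul_div_assoc]
    linarith
  have h8 : 2 * Real.exp L * (Real.exp (-(5 / 4 * S)) * Real.exp (1 / 1000 * ℓ)) *
      ((2 * Real.exp (-(1 / 4 * S)) + 8 * W / u) * (1 + Real.log (v / u)))
      ≤ 20 * Real.exp (L - 149 / 100 * ℓ) := by
    calc _ ≤ 2 * Real.exp L * (Real.exp (-(12475 / 10000 * ℓ)) * Real.exp (1 / 1000 * ℓ)) *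
          ((10 * Real.exp (-(2495 / 10000 * ℓ))) * Real.exp (1 / 1000 * ℓ)) := by
          have := hs.log_ratio
          gcongr
      _ = 20 * Real.exp (L + -(12475 / 10000 * ℓ) + 1 / 1000 * ℓ + -(2495 / 10000 * ℓ)
            + 1 / 1000 * ℓ) := by
          simp only [Real.exp_add]
          ring
      _ ≤ _ := by
          gcongr
          linarith
  linarith

lemma second_bound (hs : Scales L ℓ u v A A' B) (hS : 998 / 1000 * ℓ ≤ S)
    (hW : W ≤ Real.exp (1 / 100 * L)) {T : ℝ} (hT0 : 0 ≤ T)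
    (hT : (3 / 2) ^ ⌈3 / 2 * ℓ⌉₊ * T
      ≤ 2 * Real.exp L * (Real.exp (-(1 / 2 * S)) * Real.exp (1 / 1000 * ℓ)) + 24 * W) :
    T ≤ 26 * Real.exp (L - 11 / 10 * ℓ) := by
  have h2 := hs.two_le
  have hL := hs.le_exp
  have h3 : Real.exp (-(1 / 2 * S)) ≤ Real.exp (-(499 / 1000 * ℓ)) :=
    Real.exp_le_exp.2 (by linarith)
  have h4 : W ≤ Real.exp (L - 498 / 1000 * ℓ) := hW.trans (Real.exp_le_exp.2 (by linarith))
  have h5 : Real.exp (303 / 500 * ℓ) * T ≤ Real.exp (303 / 500 * ℓ) *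
      (26 * Real.exp (L - 11 / 10 * ℓ)) := by
    calc Real.exp (303 / 500 * ℓ) * T ≤ (3 / 2) ^ ⌈3 / 2 * ℓ⌉₊ * T := by
          gcongr
          exact le_three_halves_pow ℓ
      _ ≤ _ := hT
      _ ≤ 2 * Real.exp L * (Real.exp (-(499 / 1000 * ℓ)) * Real.exp (1 / 1000 * ℓ)) +
          24 * Real.exp (L - 498 / 1000 * ℓ) := by gcongr
      _ = 26 * Real.exp (L - 498 / 1000 * ℓ) := by
          rw [mul_assoc, ← Real.exp_add, ← Real.exp_add]
          ring_nf
      _ ≤ 26 * Real.exp (303 / 500 * ℓ + (L - 11 / 10 * ℓ)) := by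
          gcongr
          linarith
      _ = _ := by
          rw [Real.exp_add]
          ring
  exact le_of_mul_le_mul_left h5 (Real.exp_pos _)

lemma third_bound (hs : Scales L ℓ u v A A' B) (hS : 998 / 1000 * ℓ ≤ S) (hS2 : S ≤ ℓ)
    (hW : W ≤ Real.exp (1 / 100 * L)) :
    2 * Real.exp L * (Real.exp (-S) * Real.exp (1 / 1000 * ℓ)) *
          ((1 + Real.log A) * (1 + Real.log B) * (1 + Real.log (v / u)))
        + 8 * W * (A * B * v)
        + (6 * W * A' * (v * (1 + Real.log v)) +
          8 * (Real.exp L / A) * Real.exp (2 * S) * (1 + Real.log v) ^ 3)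
        + 24 * W * (Real.exp L / A') * (1 + Real.log v) ^ 3
      ≤ 48 * Real.exp (L - 99 / 100 * ℓ) := by
  have h2 := hs.two_le
  have hL := hs.le_exp
  have hu : (0 : ℝ) < u := (Real.exp_pos _).trans_le hs.le_left
  have hA : (0 : ℝ) < A := by exact_mod_cast hs.cut_pos
  have hA' : (0 : ℝ) < A' := (Real.exp_pos _).trans_le hs.le_cut'
  have hlog : 0 ≤ Real.log ((v : ℝ) / u) := by
    apply Real.log_nonneg
    rw [one_le_div hu]
    exact_mod_cast hs.le
  have hlv : 0 ≤ Real.log v := Real.log_natCast_nonneg v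
  have hlA : 0 ≤ Real.log A := Real.log_natCast_nonneg A
  have hlB : 0 ≤ Real.log B := Real.log_natCast_nonneg B
  have hv := hs.right_le
  have hrat := hs.log_ratio
  have hright := hs.log_right
  have hcutlog := hs.log_cut
  have hduallog := hs.log_dual
  have hcut := hs.cut_le
  have hcut' := hs.cut_le'
  have hdual := hs.dual_le
  have e1 : 2 * Real.exp L * (Real.exp (-S) * Real.exp (1 / 1000 * ℓ)) *
      ((1 + Real.log A) * (1 + Real.log B) * (1 + Real.log (v / u)))
      ≤ 2 * Real.exp (L - 99 / 100 * ℓ) := by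
    calc _ ≤ 2 * Real.exp L * (Real.exp (-(998 / 1000 * ℓ)) * Real.exp (1 / 1000 * ℓ)) *
          (Real.exp (1 / 1000 * ℓ) * Real.exp (1 / 1000 * ℓ) * Real.exp (1 / 1000 * ℓ)) := by
          gcongr
      _ = 2 * Real.exp (L + -(998 / 1000 * ℓ) + 1 / 1000 * ℓ + 1 / 1000 * ℓ + 1 / 1000 * ℓ
            + 1 / 1000 * ℓ) := by
          simp only [Real.exp_add]
          ring
      _ ≤ _ := by
          gcongr
          linarith
  have e2 : 8 * W * (A * B * v) ≤ 8 * Real.exp (L - 99 / 100 * ℓ) := by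
    calc 8 * W * (A * B * v) ≤ 8 * Real.exp (1 / 100 * L) *
          (Real.exp (1 / 100 * L) * Real.exp (1 / 100 * L) * Real.exp (51 / 100 * L)) := by
          gcongr
      _ = 8 * Real.exp (1 / 100 * L + 1 / 100 * L + 1 / 100 * L + 51 / 100 * L) := by
          simp only [Real.exp_add]
          ring
      _ ≤ _ := by
          gcongr
          linarith
  have e3 : 6 * W * A' * (v * (1 + Real.log v)) ≤ 6 * Real.exp (L - 99 / 100 * ℓ) := by
    calc 6 * W * A' * (v * (1 + Real.log v)) ≤ 6 * Real.exp (1 / 100 * L) *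
          Real.exp (25 / 100 * L) * (Real.exp (51 / 100 * L) * Real.exp (2 * ℓ)) := by
          gcongr
      _ = 6 * Real.exp (1 / 100 * L + 25 / 100 * L + 51 / 100 * L + 2 * ℓ) := by
          simp only [Real.exp_add]
          ring
      _ ≤ _ := by
          gcongr
          linarith
  have e4 : 8 * (Real.exp L / A) * Real.exp (2 * S) * (1 + Real.log v) ^ 3
      ≤ 8 * Real.exp (L - 99 / 100 * ℓ) := by
    calc 8 * (Real.exp L / A) * Real.exp (2 * S) * (1 + Real.log v) ^ 3
        ≤ 8 * (Real.exp L / Real.exp (10 * ℓ)) * Real.exp (2 * ℓ) * Real.exp (2 * ℓ) ^ 3 := by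
          have := hs.le_cut
          gcongr
      _ = 8 * Real.exp (L - 10 * ℓ + 2 * ℓ + 2 * ℓ + 2 * ℓ + 2 * ℓ) := by
          simp only [Real.exp_add, Real.exp_sub]
          ring
      _ ≤ _ := by
          gcongr
          linarith
  have e5 : 24 * W * (Real.exp L / A') * (1 + Real.log v) ^ 3
      ≤ 24 * Real.exp (L - 99 / 100 * ℓ) := by
    calc 24 * W * (Real.exp L / A') * (1 + Real.log v) ^ 3
        ≤ 24 * Real.exp (1 / 100 * L) * (Real.exp L / Real.exp (24 / 100 * L)) *
          Real.exp (2 * ℓ) ^ 3 := by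
          have := hs.le_cut'
          gcongr
      _ = 24 * Real.exp (1 / 100 * L + (L - 24 / 100 * L) + 2 * ℓ + 2 * ℓ + 2 * ℓ) := by
          simp only [Real.exp_add, Real.exp_sub]
          ring
      _ ≤ _ := by
          gcongr
          linarith
  linarith

end Bounds

lemma theta0_le : theta0 ≤ 1 / 25 := by
  have h1 := Real.exp_one_gt_d9
  have h2 := Real.log_two_gt_d9
  unfold theta0
  nlinarith

lemma sum_prime_le_of_scales {N R u v A A' B : ℕ} {P : Finset ℕ} {Z : ℕ} {L ℓ lo hi : ℝ}
    (hN : (N : ℝ) = Real.exp L) (hP : ∀ q ∈ P, q.Prime ∧ q ≤ Z)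
    (h : SieveRange P R Z (Real.exp (1 / 1000 * ℓ)) N) (hs : Scales L ℓ u v A A' B)
    (hS : 998 / 1000 * ℓ ≤ recipSum P) (hS2 : recipSum P ≤ ℓ)
    (hpow : ∀ k ≤ R + ⌈3 / 2 * ℓ⌉₊, (Z : ℝ) ^ k ≤ Real.exp (1 / 100 * L)) (hR : 2 ≤ R)
    (hlo : 0 ≤ lo) (hu : ⌊lo⌋₊ = u) (hv : ⌈hi⌉₊ = v) :
    (∑ p ∈ range (N + 1), if p.Prime then |∑ d ∈ (p - 1).divisors,
        if lo < (d : ℝ) ∧ (d : ℝ) < hi then chi4 d else 0| else 0)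
      ≤ 100 * Real.exp (L - 104 / 100 * ℓ) := by
  have hℓ := hs.two_le
  have hL := hs.le_exp
  have hvN : v ≤ N := by
    have : (v : ℝ) ≤ N := by
      rw [hN]
      exact hs.right_le.trans (Real.exp_le_exp.2 (by linarith))
    exact_mod_cast this
  have hWR := hpow R (by omega)
  have t1 := h.sum_sifted_thin_card_le (N := N) hs.one_le hs.le hvN
  have t2 := h.sum_sifted_omegaIn_le le_rfl ⌈3 / 2 * ℓ⌉₊
  have t3 := h.sum_brun_charSum_sq_le le_rfl hs.one_le hs.le hs.cut_pos hs.cut_le_cut hs.mul_le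
  have hT0 : 0 ≤ ∑ n ∈ Icc 1 N, if ⌈3 / 2 * ℓ⌉₊ ≤ omegaIn P n then sifted P n else 0 :=
    Finset.sum_nonneg fun n _ => by
      have := sifted_nonneg P n
      split_ifs <;> simp [this]
  rw [hN] at t1 t2 t3
  have t1' := t1.trans (first_bound hs hS (by positivity) hWR)
  have t3' := t3.trans (third_bound hs hS hS2 hWR)
  have t2' := second_bound hs hS (hpow _ le_rfl) hT0 t2
  have hsq : √((∑ n ∈ Icc 1 N, if ⌈3 / 2 * ℓ⌉₊ ≤ omegaIn P n then sifted P n else 0) *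
      ∑ n ∈ Icc 1 N, brun P R n * charSum u v n ^ 2) ≤ 36 * Real.exp (L - 104 / 100 * ℓ) := by
    rw [Real.sqrt_le_left (by positivity)]
    calc _ ≤ (26 * Real.exp (L - 11 / 10 * ℓ)) * (48 * Real.exp (L - 99 / 100 * ℓ)) := by
          gcongr
          exact Finset.sum_nonneg fun n _ => mul_nonneg (brun_nonneg h.even n) (sq_nonneg _)
      _ = 1248 * Real.exp ((L - 11 / 10 * ℓ) + (L - 99 / 100 * ℓ)) := by
          rw [Real.exp_add]
          ring
      _ ≤ 1296 * Real.exp ((L - 104 / 100 * ℓ) + (L - 104 / 100 * ℓ)) := by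
          apply mul_le_mul (by norm_num) (Real.exp_le_exp.2 (by linarith)) (Real.exp_pos _).le
          norm_num
      _ = _ := by
          rw [Real.exp_add]
          ring
  have hfirst : (4 / 3) ^ ⌈3 / 2 * ℓ⌉₊ *
      ∑ n ∈ Icc 1 N, sifted P n * thin P n * #{d ∈ Ioo u v | d ∣ n}
      ≤ 56 * Real.exp (L - 104 / 100 * ℓ) := by
    calc _ ≤ (2 * Real.exp (11 / 25 * ℓ)) * (28 * Real.exp (L - 149 / 100 * ℓ)) := by
          have h43 := four_thirds_pow_le (ℓ := ℓ) (by linarith)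
          exact mul_le_mul h43 t1' (Finset.sum_nonneg fun n _ => mul_nonneg
            (mul_nonneg (sifted_nonneg P n) (thin_nonneg P n)) (Nat.cast_nonneg _)) (by positivity)
      _ = 56 * Real.exp (11 / 25 * ℓ + (L - 149 / 100 * ℓ)) := by
          rw [Real.exp_add]
          ring
      _ ≤ _ := by
          gcongr
          linarith
  have hZ2 : (Z : ℝ) ^ 2 ≤ Real.exp (L - 104 / 100 * ℓ) :=
    (hpow 2 (by omega)).trans (Real.exp_le_exp.2 (by linarith))
  have hmain := sum_prime_abs_sum_divisors_le hP hlo N (hi := hi)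
  rw [hu, hv] at hmain
  have hcomb := sum_sifted_abs_charSum_le (P := P) h.even N u v ⌈3 / 2 * ℓ⌉₊
  have hpos := Real.exp_pos (L - 104 / 100 * ℓ)
  linarith

/-- Hooley:
∑_{p ≤ N} |∑_{d ∣ p-1, √N L^{-ω} < d < √N L^{ω}} χ(d)| ≪ N L^{-1-θ₀} (log L)⁵. -/
theorem hooley_first_moment :
    ∀ ω : ℝ, 0 < ω → ∃ C : ℝ, 0 < C ∧ ∃ N0 : ℕ, ∀ N : ℕ, N0 ≤ N →
      (∑ p ∈ Finset.range (N + 1),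
          if p.Prime then
            |∑ d ∈ (p - 1).divisors,
                if Real.sqrt N * Real.log N ^ (-ω) < (d : ℝ) ∧
                    (d : ℝ) < Real.sqrt N * Real.log N ^ ω then
                  chi4 d
                else 0|
          else 0) ≤
        C * (N : ℝ) * Real.log N ^ (-1 - theta0) * Real.log (Real.log N) ^ 5 := by
  intro ω hω
  refine ⟨100, by norm_num, ?_⟩
  rw [← Filter.eventually_atTop]
  filter_upwards [eventually_sieveRange, eventually_sieveLimit_pow_le,
    Filter.eventually_ge_atTop 1, tendsto_log_natCast.eventually_ge_atTop 1,
    tendsto_log_log_natCast.eventually_ge_atTop 2,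
    tendsto_log_log_natCast.eventually
      (eventually_le_exp one_pos (2000 + 200 * ω) 1000),
    tendsto_log_log_natCast.eventually
      (eventually_le_exp (by norm_num : (0 : ℝ) < 1 / 1000) (10 + 2 * ω) 5)]
    with N ⟨hrange, hS, hS2⟩ hpow hN1 hL1 hℓ h3 h4
  have hN : (N : ℝ) = Real.exp (Real.log N) := (Real.exp_log (by exact_mod_cast hN1)).symm
  have hLe : Real.log N = Real.exp (Real.log (Real.log N)) := (Real.exp_log (by linarith)).symm
  set ℓ := Real.log (Real.log N)
  rw [one_mul, ← hLe] at h3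
  have hscale := scales_of_bounds hω hLe hℓ h3 h4
  have hsqrt : √(N : ℝ) = Real.exp (Real.log N / 2) := by
    rw [Real.exp_half, ← hN]
  have hlo : √(N : ℝ) * Real.log N ^ (-ω) = Real.exp (Real.log N / 2 - ω * ℓ) := by
    rw [hsqrt, Real.rpow_def_of_pos (by linarith), ← Real.exp_add]
    congr 1
    ring
  have hhi : √(N : ℝ) * Real.log N ^ ω = Real.exp (Real.log N / 2 + ω * ℓ) := by
    rw [hsqrt, Real.rpow_def_of_pos (by linarith), ← Real.exp_add]
    congr 1
    ring
  have hR : 2 ≤ sieveLevel N := by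
    have : 0 < ⌈5 * ℓ⌉₊ := Nat.ceil_pos.2 (by linarith)
    change 2 ≤ 2 * ⌈5 * ℓ⌉₊
    omega
  refine (sum_prime_le_of_scales hN (fun q hq => ⟨(mem_sievePrimes hq).1, (mem_sievePrimes hq).2.1⟩)
    hrange hscale hS hS2 hpow hR (by positivity) (by rw [hlo]) (by rw [hhi])).trans ?_
  have hpowlog : Real.log N ^ (-1 - theta0) = Real.exp (ℓ * (-1 - theta0)) :=
    Real.rpow_def_of_pos (by linarith) _
  calc 100 * Real.exp (Real.log N - 104 / 100 * ℓ)
      ≤ 100 * Real.exp (Real.log N + ℓ * (-1 - theta0)) := by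
        have := theta0_le
        gcongr
        nlinarith
    _ = 100 * (N : ℝ) * Real.log N ^ (-1 - theta0) * 1 := by
        rw [Real.exp_add, ← hN, hpowlog]
        ring
    _ ≤ _ := by
        have : 1 ≤ ℓ ^ 5 := one_le_pow₀ (by linarith)
        gcongr
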